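/- arXiv:1006.3994 — 12 statements merged into one kernel-verified Lean document; each statement's English description precedes it below -/
import Mathlib

section
/- Let A = (a_{kl}) be a real n×n matrix such that every column of A sums to 1 (i.e. ∑_{k=1}^n a_{kl} = 1 for each l) and every off-diagonal entry of A is ≤ 0. Then A is invertible, every eigenvalue of A⁻¹ has modulus at most 1, and the matrix 1-norm of A⁻¹ (the maximum over columns of the sum of absolute values of the entries) equals 1. -/
open scoped BigOperators

theorem key_aux {n : ℕ} (A : Matrix (Fin n) (Fin n) ℝ)
    (hcol : ∀ l, ∑ k, A k l = 1)
    (hoff : ∀ k l, k ≠ l → A k l ≤ 0) (x : Fin n → ℝ) :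
    ∑ k, |x k| ≤ ∑ k, |A.mulVec x k| := by
  have h1 : ∀ k, ∑ l, A k l * |x l| ≤ |A.mulVec x k| := by
    intro k
    obtain ⟨s, hs, hsk⟩ : ∃ s : ℝ, |s| = 1 ∧ s * x k = |x k| := by
      rcases le_total 0 (x k) with h | h
      · exact ⟨1, by simp, by simp [abs_of_nonneg h]⟩
      · exact ⟨-1, by simp, by simp [abs_of_nonpos h]⟩
    calc ∑ l, A k l * |x l| ≤ ∑ l, A k l * (s * x l) := by
          refine Finset.sum_le_sum fun l _ => ?_
          by_cases hkl : k = l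
          · subst hkl; rw [hsk]
          · refine mul_le_mul_of_nonpos_left ?_ (hoff k l hkl)
            calc s * x l ≤ |s * x l| := le_abs_self _
              _ = |x l| := by rw [abs_mul, hs, one_mul]
      _ = s * A.mulVec x k := by
          simp only [Matrix.mulVec, dotProduct, Finset.mul_sum]
          exact Finset.sum_congr rfl fun l _ => by ring
      _ ≤ |s * A.mulVec x k| := le_abs_self _
      _ = _ := by rw [abs_mul, hs, one_mul]
  calc ∑ k, |x k| = ∑ l, ∑ k, A k l * |x l| := by
        simp only [← Finset.sum_mul, hcol, one_mul]
    _ = ∑ k, ∑ l, A k l * |x l| := Finset.sum_comm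
    _ ≤ _ := Finset.sum_le_sum fun k _ => h1 k

/-- Let `A` be a real `n × n` matrix (`n ≥ 1`) such that every column of `A`
sums to `1` and every off-diagonal entry is `≤ 0`.  Then `A` is invertible, every (complex)
eigenvalue of `A⁻¹` has modulus at most `1`, and the matrix 1-norm of `A⁻¹`
(the maximum over columns of the sum of the absolute values of the entries) equals `1`. -/
theorem stmt0 (n : ℕ) (hn : 1 ≤ n) (A : Matrix (Fin n) (Fin n) ℝ)
    (hcol : ∀ l, ∑ k, A k l = 1)
    (hoff : ∀ k l, k ≠ l → A k l ≤ 0) :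
    IsUnit A ∧
    (∀ (μ : ℂ) (v : Fin n → ℂ), v ≠ 0 →
      (A⁻¹.map (algebraMap ℝ ℂ)).mulVec v = μ • v → ‖μ‖ ≤ 1) ∧
    (⨆ l : Fin n, ∑ k, |A⁻¹ k l|) = 1 := by
  have hU : IsUnit A := by
    rw [← Matrix.mulVec_injective_iff_isUnit]
    intro x y hxy
    have h := key_aux A hcol hoff (x - y)
    have h0 : A.mulVec (x - y) = 0 := by
      rw [Matrix.mulVec_sub]; exact sub_eq_zero.2 hxy
    rw [h0] at h
    simp only [Pi.zero_apply, abs_zero, Finset.sum_const_zero] at h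
    have h2 := (Finset.sum_eq_zero_iff_of_nonneg (fun k _ => abs_nonneg _)).1
      (le_antisymm h (Finset.sum_nonneg fun k _ => abs_nonneg _))
    ext k
    have := h2 k (Finset.mem_univ k)
    simpa [sub_eq_zero] using this
  have hdet : IsUnit A.det := (Matrix.isUnit_iff_isUnit_det A).1 hU
  have hsum : ∀ l, ∑ k, A⁻¹ k l = 1 := by
    intro l
    have h1 : Matrix.vecMul (fun _ => (1 : ℝ)) A = fun _ => 1 := by
      ext l; simp [Matrix.vecMul, dotProduct, hcol]
    have h2 : Matrix.vecMul (fun _ => (1 : ℝ)) A⁻¹ = fun _ => 1 := by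
      conv_lhs => rw [← h1]
      rw [Matrix.vecMul_vecMul, Matrix.mul_nonsing_inv A hdet, Matrix.vecMul_one]
    have := congrFun h2 l
    simpa [Matrix.vecMul, dotProduct] using this
  have habs : ∀ l, ∑ k, |A⁻¹ k l| = 1 := by
    intro l
    apply le_antisymm
    · have h := key_aux A hcol hoff (fun k => A⁻¹ k l)
      have h3 : A.mulVec (fun k => A⁻¹ k l) = fun k => (1 : Matrix (Fin n) (Fin n) ℝ) k l := by
        rw [← Matrix.mul_nonsing_inv A hdet]
        rfl
      rw [h3] at h
      refine h.trans (le_of_eq ?_)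
      rw [Finset.sum_eq_single l]
      · simp
      · intro b _ hb; simp [Matrix.one_apply, hb]
      · simp
    · rw [← hsum l]
      exact Finset.sum_le_sum fun k _ => le_abs_self _
  refine ⟨hU, ?_, ?_⟩
  · intro μ v hv hμ
    have hpos : 0 < ∑ k, ‖v k‖ := by
      obtain ⟨k, hk⟩ := Function.ne_iff.1 hv
      exact Finset.sum_pos' (fun _ _ => norm_nonneg _)
        ⟨k, Finset.mem_univ k, norm_pos_iff.2 hk⟩
    have hle : ‖μ‖ * ∑ k, ‖v k‖ ≤ 1 * ∑ k, ‖v k‖ := by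
      calc ‖μ‖ * ∑ k, ‖v k‖ = ∑ k, ‖(A⁻¹.map (algebraMap ℝ ℂ)).mulVec v k‖ := by
            rw [hμ]; simp [Finset.mul_sum]
        _ ≤ ∑ k, ∑ l, |A⁻¹ k l| * ‖v l‖ := by
            refine Finset.sum_le_sum fun k _ => ?_
            simp only [Matrix.mulVec, dotProduct]
            refine (norm_sum_le _ _).trans (le_of_eq ?_)
            exact Finset.sum_congr rfl fun l _ => by simp
        _ = ∑ l, ∑ k, |A⁻¹ k l| * ‖v l‖ := Finset.sum_comm
        _ = _ := by simp only [← Finset.sum_mul, habs, one_mul]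
    exact le_of_mul_le_mul_right hle hpos
  · haveI : Nonempty (Fin n) := ⟨⟨0, hn⟩⟩
    simp only [habs, ciSup_const]
end

section
/- Let A = (a_{kl}) be a real n×n matrix such that every column of A sums to 1 and every off-diagonal entry of A is ≤ 0. Then every complex eigenvalue λ of A satisfies |λ| ≥ 1. -/
open scoped BigOperators

/-- Let `A` be a real `n × n` matrix (`n ≥ 1`) such that every column of `A`
sums to `1` and every off-diagonal entry is `≤ 0`.  Then every complex eigenvalue `μ` of `A`
satisfies `|μ| ≥ 1`. -/
theorem stmt1 (n : ℕ) (hn : 1 ≤ n) (A : Matrix (Fin n) (Fin n) ℝ)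
    (hcol : ∀ l, ∑ k, A k l = 1)
    (hoff : ∀ k l, k ≠ l → A k l ≤ 0) :
    ∀ (μ : ℂ) (v : Fin n → ℂ), v ≠ 0 →
      (A.map (algebraMap ℝ ℂ)).mulVec v = μ • v → 1 ≤ ‖μ‖ := by
  intro μ v hv h
  by_contra! hlt
  set B : Matrix (Fin n) (Fin n) ℂ := A.map (algebraMap ℝ ℂ) - μ • (1 : Matrix (Fin n) (Fin n) ℂ) with hB
  have hdet : B.det = 0 := by
    apply Matrix.exists_mulVec_eq_zero_iff.mp
    refine ⟨v, hv, ?_⟩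
    rw [hB, Matrix.sub_mulVec, h, Matrix.smul_mulVec, Matrix.one_mulVec, sub_self]
  refine det_ne_zero_of_sum_col_lt_diag (A := B) ?_ hdet
  intro k
  have h1 : ∑ i ∈ Finset.univ.erase k, ‖B i k‖ = ∑ i ∈ Finset.univ.erase k, -A i k := by
    apply Finset.sum_congr rfl
    intro i hi
    have hik : i ≠ k := (Finset.mem_erase.mp hi).1
    have : B i k = (A i k : ℂ) := by simp [hB, Matrix.one_apply, hik]
    rw [this, Complex.norm_real, Real.norm_eq_abs, abs_of_nonpos (hoff i k hik)]
  have h2 := Finset.add_sum_erase Finset.univ (fun i => A i k) (Finset.mem_univ k)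
  have h3 : B k k = (A k k : ℂ) - μ := by simp [hB]
  have h4 := norm_sub_norm_le (A k k : ℂ) μ
  rw [Complex.norm_real, Real.norm_eq_abs] at h4
  have h5 := le_abs_self (A k k)
  have h6 := hcol k
  rw [h1, h3, Finset.sum_neg_distrib]
  linarith
end

section
/- Let A = (a_{kl}) be a real n×n matrix such that every column of A sums to 1 and every off-diagonal entry of A is ≤ 0. Then A is invertible, every entry of A⁻¹ is nonnegative, and every column of A⁻¹ sums to 1. -/
open scoped BigOperators

/-- Let `A` be a real `n × n` matrix (`n ≥ 1`) such that every column of `A`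
sums to `1` and every off-diagonal entry is `≤ 0`.  Then `A` is invertible, every entry of
`A⁻¹` is nonnegative, and every column of `A⁻¹` sums to `1`. -/
theorem stmt2 (n : ℕ) (hn : 1 ≤ n) (A : Matrix (Fin n) (Fin n) ℝ)
    (hcol : ∀ l, ∑ k, A k l = 1)
    (hoff : ∀ k l, k ≠ l → A k l ≤ 0) :
    IsUnit A ∧ (∀ k l, 0 ≤ A⁻¹ k l) ∧ (∀ l, ∑ k, A⁻¹ k l = 1) := by
  have hdet : A.det ≠ 0 := by
    apply det_ne_zero_of_sum_col_lt_diag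
    intro k
    have h1 : ∑ i ∈ Finset.univ.erase k, ‖A i k‖ = - ∑ i ∈ Finset.univ.erase k, A i k := by
      rw [← Finset.sum_neg_distrib]
      refine Finset.sum_congr rfl fun i hi => ?_
      rw [Real.norm_eq_abs, abs_of_nonpos (hoff i k (Finset.ne_of_mem_erase hi))]
    have h2 := Finset.add_sum_erase Finset.univ (fun i => A i k) (Finset.mem_univ k)
    have h3 := hcol k
    have h4 := le_abs_self (A k k)
    rw [h1, Real.norm_eq_abs]
    linarith
  have hu : IsUnit A.det := isUnit_iff_ne_zero.mpr hdet
  have hBA : A⁻¹ * A = 1 := Matrix.nonsing_inv_mul A hu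
  have hAB : A * A⁻¹ = 1 := Matrix.mul_nonsing_inv A hu
  refine ⟨(Matrix.isUnit_iff_isUnit_det A).mpr hu, ?_, ?_⟩
  · intro k l
    obtain ⟨m, -, hm⟩ := Finset.exists_min_image Finset.univ (fun j => A⁻¹ k j)
      ⟨l, Finset.mem_univ l⟩
    refine le_trans ?_ (hm l (Finset.mem_univ l))
    have h1 : ∑ i, A⁻¹ k i * A i m = (1 : Matrix (Fin n) (Fin n) ℝ) k m := by
      rw [← hBA, Matrix.mul_apply]
    have h2 : (0 : ℝ) ≤ (1 : Matrix (Fin n) (Fin n) ℝ) k m := by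
      rw [Matrix.one_apply]
      split_ifs <;> norm_num
    have h3 : ∑ i, A⁻¹ k i * A i m ≤ ∑ i, A⁻¹ k m * A i m := by
      refine Finset.sum_le_sum fun i _ => ?_
      by_cases h : i = m
      · rw [h]
      · exact mul_le_mul_of_nonpos_right (hm i (Finset.mem_univ i)) (hoff i m h)
    rw [← Finset.mul_sum, hcol, mul_one] at h3
    linarith
  · intro l
    have h1 : ∑ k, (A * A⁻¹) k l = 1 := by
      rw [hAB]
      simp [Matrix.one_apply]
    simp only [Matrix.mul_apply] at h1
    rw [Finset.sum_comm] at h1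
    simpa only [← Finset.sum_mul, hcol, one_mul] using h1
end

section
/- Fix r ≥ 2 and real numbers A_1,…,A_{r−1} < 0 and B_1,…,B_{r−1} > 0. Let 𝒬 be the r×r matrix with entries 𝒬_{11} = A_1, 𝒬_{12} = B_1, 𝒬_{i,i−1} = −A_{i−1} and 𝒬_{ii} = −B_{i−1} + A_i and 𝒬_{i,i+1} = B_i for 1 < i < r, 𝒬_{r,r−1} = −A_{r−1}, 𝒬_{rr} = −B_{r−1}, and all other entries 0. Then for every μ > 0, the matrix I − μ𝒬 is invertible, every eigenvalue of (I − μ𝒬)⁻¹ has modulus at most 1, and the matrix 1-norm of (I − μ𝒬)⁻¹ equals 1. -/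
open scoped BigOperators

/-- The `r × r` Jacobian-type matrix `𝒬` (with `r = m + 2`) built from the numbers
`A_1, …, A_{r-1}` and `B_1, …, B_{r-1}`:
`𝒬_{11} = A_1`, `𝒬_{12} = B_1`, `𝒬_{i,i-1} = -A_{i-1}`, `𝒬_{ii} = -B_{i-1} + A_i`,
`𝒬_{i,i+1} = B_i` for `1 < i < r`, `𝒬_{r,r-1} = -A_{r-1}`, `𝒬_{rr} = -B_{r-1}`,
all other entries being `0`. -/
noncomputable def Qcal (m : ℕ) (A B : Fin (m + 1) → ℝ) :
    Matrix (Fin (m + 2)) (Fin (m + 2)) ℝ :=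
  fun k l => ∑ i : Fin (m + 1),
    (if k = i.castSucc then (1 : ℝ) else if k = i.succ then -1 else 0) *
    (if l = i.castSucc then A i else if l = i.succ then B i else 0)

theorem Qcal_offdiag (m : ℕ) (A B : Fin (m + 1) → ℝ)
    (hA : ∀ i, A i < 0) (hB : ∀ i, 0 < B i) (k l : Fin (m + 2)) (h : k ≠ l) :
    0 ≤ Qcal m A B k l := by
  unfold Qcal
  refine Finset.sum_nonneg fun i _ => ?_
  have h1 := hA i
  have h2 := hB i
  split_ifs <;> first | (exfalso; apply h; simp_all; done) | (simp; done) | (simp; linarith)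

theorem Qcal_colsum (m : ℕ) (A B : Fin (m + 1) → ℝ) (l : Fin (m + 2)) :
    ∑ k, Qcal m A B k l = 0 := by
  unfold Qcal
  rw [Finset.sum_comm]
  refine Finset.sum_eq_zero fun i _ => ?_
  rw [← Finset.sum_mul]
  have : ∑ k : Fin (m + 2), (if k = i.castSucc then (1 : ℝ) else if k = i.succ then -1 else 0) = 0 := by
    have h : ∀ k : Fin (m + 2), (if k = i.castSucc then (1 : ℝ) else if k = i.succ then -1 else 0)
        = (if k = i.castSucc then (1 : ℝ) else 0) - (if k = i.succ then 1 else 0) := by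
      intro k
      have hne : i.castSucc ≠ i.succ := Fin.castSucc_lt_succ.ne
      by_cases h1 : k = i.castSucc
      · subst h1; simp [hne]
      · simp only [h1, if_false]; split_ifs <;> simp
    simp only [h, Finset.sum_sub_distrib]
    simp
  rw [this, zero_mul]

theorem norm_expand {𝕜 : Type*} [RCLike 𝕜] {n : Type*} [Fintype n] [DecidableEq n]
    (M : Matrix n n ℝ) (hoff : ∀ k l, k ≠ l → M k l ≤ 0) (hcol : ∀ l, ∑ k, M k l = 1)
    (w : n → 𝕜) :
    ∑ k, ‖w k‖ ≤ ∑ k, ‖(M.map (algebraMap ℝ 𝕜)).mulVec w k‖ := by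
  have key : ∀ l, ∑ k, M l k * ‖w k‖ ≤ ‖(M.map (algebraMap ℝ 𝕜)).mulVec w l‖ := by
    intro l
    have hd : 0 ≤ M l l := by
      have h1 := hcol l
      rw [← Finset.add_sum_erase _ _ (Finset.mem_univ l)] at h1
      have h2 : ∑ k ∈ Finset.univ.erase l, M k l ≤ 0 :=
        Finset.sum_nonpos fun k hk => hoff k l (Finset.ne_of_mem_erase hk)
      linarith
    have e : (M.map (algebraMap ℝ 𝕜)).mulVec w l = M l l • w l
        + ∑ k ∈ Finset.univ.erase l, M l k • w k := by
      rw [Finset.add_sum_erase _ (fun k => M l k • w k) (Finset.mem_univ l)]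
      simp [Matrix.mulVec, dotProduct, Algebra.smul_def]
    rw [← Finset.add_sum_erase _ _ (Finset.mem_univ l)]
    have h3 : ‖∑ k ∈ Finset.univ.erase l, M l k • w k‖
        ≤ - ∑ k ∈ Finset.univ.erase l, M l k * ‖w k‖ := by
      rw [← Finset.sum_neg_distrib]
      refine norm_sum_le_of_le _ fun k hk => ?_
      rw [norm_smul, Real.norm_eq_abs,
        abs_of_nonpos (hoff l k (Finset.ne_of_mem_erase hk).symm), neg_mul]
    have h4 : ‖M l l • w l‖ = M l l * ‖w l‖ := by
      rw [norm_smul, Real.norm_eq_abs, abs_of_nonneg hd]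
    have h5 : ‖M l l • w l‖ - ‖∑ k ∈ Finset.univ.erase l, M l k • w k‖ ≤ ‖(M.map (algebraMap ℝ 𝕜)).mulVec w l‖ := by
      rw [e]
      exact norm_sub_le_norm_add _ _
    linarith
  calc ∑ k, ‖w k‖ = ∑ k, ∑ l, M l k * ‖w k‖ := by
        refine Finset.sum_congr rfl fun k _ => ?_
        rw [← Finset.sum_mul, hcol, one_mul]
    _ = ∑ l, ∑ k, M l k * ‖w k‖ := Finset.sum_comm
    _ ≤ _ := Finset.sum_le_sum fun l _ => key l

/-- Fix `r = m + 2 ≥ 2` and real numbers `A_i < 0`, `B_i > 0`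
(`i = 1, …, r-1`), and let `𝒬` be the matrix described above.  Then for every `μ > 0`
the matrix `I - μ𝒬` is invertible, every (complex) eigenvalue of `(I - μ𝒬)⁻¹` has modulus
at most `1`, and the matrix 1-norm (maximum column absolute sum) of `(I - μ𝒬)⁻¹` is `1`. -/
theorem stmt3 (m : ℕ) (A B : Fin (m + 1) → ℝ)
    (hA : ∀ i, A i < 0) (hB : ∀ i, 0 < B i) (μ : ℝ) (hμ : 0 < μ) :
    IsUnit (1 - μ • Qcal m A B) ∧
    (∀ (z : ℂ) (v : Fin (m + 2) → ℂ), v ≠ 0 →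
      ((1 - μ • Qcal m A B)⁻¹.map (algebraMap ℝ ℂ)).mulVec v = z • v → ‖z‖ ≤ 1) ∧
    (⨆ l : Fin (m + 2), ∑ k, |(1 - μ • Qcal m A B)⁻¹ k l|) = 1 := by
  have hoff : ∀ k l, k ≠ l → (1 - μ • Qcal m A B) k l ≤ 0 := by
    intro k l h
    have := mul_nonneg hμ.le (Qcal_offdiag m A B hA hB k l h)
    simp [Matrix.one_apply_ne h, this]
  have hcol : ∀ l, ∑ k, (1 - μ • Qcal m A B) k l = 1 := by
    intro l
    simp [Finset.sum_sub_distrib, ← Finset.mul_sum, Qcal_colsum, Matrix.one_apply]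
  generalize (1 - μ • Qcal m A B) = M at hoff hcol
  have hR : ∀ w : Fin (m + 2) → ℝ, ∑ k, |w k| ≤ ∑ k, |M.mulVec w k| :=
    fun w => norm_expand (𝕜 := ℝ) M hoff hcol w
  have hU : IsUnit M := by
    rw [← Matrix.mulVec_injective_iff_isUnit]
    intro x y hxy
    have h0 : M.mulVec (x - y) = 0 := by
      rw [Matrix.mulVec_sub]; exact sub_eq_zero.2 hxy
    have h1 := hR (x - y)
    rw [h0] at h1
    simp only [Pi.zero_apply, abs_zero, Finset.sum_const_zero] at h1
    have h2 := (Finset.sum_eq_zero_iff_of_nonneg (fun k _ => abs_nonneg ((x - y) k))).1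
      (le_antisymm h1 (Finset.sum_nonneg fun k _ => abs_nonneg _))
    ext k
    have := abs_eq_zero.1 (h2 k (Finset.mem_univ k))
    exact sub_eq_zero.1 this
  have hdet : IsUnit M.det := (Matrix.isUnit_iff_isUnit_det M).1 hU
  have hMN : M * M⁻¹ = 1 := Matrix.mul_nonsing_inv M hdet
  refine ⟨hU, ?_, ?_⟩
  · intro z v hv hz
    have h1 := norm_expand (𝕜 := ℂ) M hoff hcol ((M⁻¹.map (algebraMap ℝ ℂ)).mulVec v)
    rw [Matrix.mulVec_mulVec, ← Matrix.map_mul, hMN, hz] at h1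
    rw [Matrix.map_one _ (map_zero _) (map_one _), Matrix.one_mulVec] at h1
    simp only [Pi.smul_apply, norm_smul, ← Finset.mul_sum] at h1
    have hpos : 0 < ∑ k, ‖v k‖ := by
      obtain ⟨k, hk⟩ := Function.ne_iff.1 hv
      exact Finset.sum_pos' (fun _ _ => norm_nonneg _) ⟨k, Finset.mem_univ k, norm_pos_iff.2 hk⟩
    exact le_of_mul_le_mul_right (by linarith) hpos
  · have hone : ∀ l, ∑ k, |M⁻¹ k l| = 1 := by
      intro l
      apply le_antisymm
      · have h1 := hR (fun k => M⁻¹ k l)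
        have h2 : M.mulVec (fun k => M⁻¹ k l) = fun k => (1 : Matrix _ _ ℝ) k l := by
          rw [← hMN]; rfl
        rw [h2] at h1
        refine h1.trans (le_of_eq ?_)
        rw [Finset.sum_eq_single l] <;> simp +contextual [Matrix.one_apply]
      · have hs : ∑ k, M⁻¹ k l = 1 := by
          have h1 : ∑ k, (M * M⁻¹) k l = ∑ j, M⁻¹ j l := by
            simp only [Matrix.mul_apply]
            rw [Finset.sum_comm]
            simp only [← Finset.sum_mul, hcol, one_mul]
          rw [← h1, hMN]
          simp [Matrix.one_apply]
        rw [← hs]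
        exact Finset.sum_le_sum fun k _ => le_abs_self _
    simp only [hone]
    exact ciSup_const
end

section
/- Given any vectors U_{j−1}, U_j, U_{j+1} ∈ ℝ^r and any Δt, Δx, ε > 0, there exists a unique W ∈ ℝ^r satisfying the implicit equation (W − U_j)/Δt + Λ⁺(U_j − U_{j−1})/Δx + Λ⁻(U_{j+1} − U_j)/Δx = (1/ε) Q(W). That is, each time step of the semi-implicit upwind scheme is uniquely solvable. -/
open scoped BigOperators

noncomputable section

/-- The 1-norm `|V| = ∑ i |v_i|` on `ℝ^r`. -/
def onenorm {r : ℕ} (V : Fin r → ℝ) : ℝ := ∑ i, |V i|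

/-- The reaction term `Q(U) = (f_1, f_2 - f_1, …, f_i - f_{i-1}, …, -f_{r-1})`
for `U ∈ ℝ^r` with `r = m + 2`, built from `f_i = f_i (u_i, u_{i+1})`. -/
def Qr (m : ℕ) (f : Fin (m + 1) → ℝ → ℝ → ℝ) (U : Fin (m + 2) → ℝ) :
    Fin (m + 2) → ℝ :=
  fun k =>
    (∑ i : Fin (m + 1), if k = i.castSucc then f i (U i.castSucc) (U i.succ) else 0)
      - ∑ i : Fin (m + 1), if k = i.succ then f i (U i.castSucc) (U i.succ) else 0

/-- The semi-implicit upwind scheme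
`(U_j^{n+1} - U_j^n)/Δt + Λ⁺(U_j^n - U_{j-1}^n)/Δx + Λ⁻(U_{j+1}^n - U_j^n)/Δx
  = (1/ε) Q(U_j^{n+1})`,
where `λ_i^± = (λ_i ± |λ_i|)/2` and `Λ^± = diag(λ_1^±, …, λ_r^±)`. -/
def Scheme (m : ℕ) (f : Fin (m + 1) → ℝ → ℝ → ℝ) (lam : Fin (m + 2) → ℝ)
    (Δt Δx ε : ℝ) (U : ℕ → ℤ → Fin (m + 2) → ℝ) : Prop :=
  ∀ (n : ℕ) (j : ℤ) (i : Fin (m + 2)),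
    (U (n + 1) j i - U n j i) / Δt
      + (lam i + |lam i|) / 2 * (U n j i - U n (j - 1) i) / Δx
      + (lam i - |lam i|) / 2 * (U n (j + 1) i - U n j i) / Δx
    = (1 / ε) * Qr m f (U (n + 1) j) i

/-- The CFL condition `(Δt/Δx) · max_i |λ_i| ≤ 1`. -/
def CFL (m : ℕ) (lam : Fin (m + 2) → ℝ) (Δt Δx : ℝ) : Prop :=
  ∀ i, Δt / Δx * |lam i| ≤ 1

end

lemma one_dim_aux (h : ℝ → ℝ) (hc : Continuous h) (hm : Monotone fun x => h x - x) :
    StrictMono h ∧ Function.Surjective h := by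
  have hs : StrictMono h := by
    intro x y hxy
    have := hm hxy.le
    simp only at this
    linarith
  refine ⟨hs, hc.surjective ?_ ?_⟩
  · refine Filter.tendsto_atTop_mono' _ ?_ (Filter.tendsto_atTop_add_const_right _ (h 0) Filter.tendsto_id)
    filter_upwards [Filter.eventually_ge_atTop 0] with x hx
    have := hm hx
    simp only [id] at this ⊢
    linarith
  · refine Filter.tendsto_atBot_mono' _ ?_ (Filter.tendsto_atBot_add_const_right _ (h 0) Filter.tendsto_id)
    filter_upwards [Filter.eventually_le_atBot 0] with x hx
    have := hm hx
    simp only [id] at this ⊢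
    linarith

lemma elim_aux (F : ℝ → ℝ) (hFc : Continuous F) (hFm : Monotone F)
    (f : ℝ → ℝ → ℝ) (hc : Continuous fun p : ℝ × ℝ => f p.1 p.2)
    (h1 : ∀ w, Antitone fun v => f v w) (h2 : ∀ v, Monotone fun w => f v w) (b : ℝ) :
    ∃ g : ℝ → ℝ, (∀ x y, x + F x - f x y = b ↔ x = g y) ∧
      Continuous (fun y => f (g y) y) ∧ Monotone (fun y => f (g y) y) := by
  have key : ∀ y, StrictMono (fun x => x + F x - f x y) ∧
      Function.Surjective (fun x => x + F x - f x y) := by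
    intro y
    apply one_dim_aux
    · have : Continuous fun x => f x y := hc.comp (by fun_prop : Continuous fun x : ℝ => (x, y))
      fun_prop
    · intro u v huv
      have a1 := hFm huv
      have a2 := h1 y huv
      simp only at a2 ⊢
      linarith
  choose g hg using fun y => (key y).2 b
  simp only at hg
  have hgm : Monotone g := by
    intro y z hyz
    rw [← (key z).1.le_iff_le]
    have := h2 (g y) hyz
    have e1 := hg y
    have e2 := hg z
    simp only at this ⊢
    linarith
  have hfy : ∀ a, Continuous fun y => f a y := fun a =>
    hc.comp (by fun_prop : Continuous fun x : ℝ => (a, x))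
  have hgc : Continuous g := by
    rw [OrderTopology.continuous_iff]
    intro a
    constructor
    · have : g ⁻¹' Set.Ioi a = {y | a + F a - f a y < b} := by
        ext y
        simp only [Set.mem_preimage, Set.mem_Ioi, Set.mem_ofPred_eq]
        rw [← (key y).1.lt_iff_lt]
        simp only [hg y]
      rw [this]
      have := hfy a
      exact isOpen_lt (by fun_prop) continuous_const
    · have : g ⁻¹' Set.Iio a = {y | b < a + F a - f a y} := by
        ext y
        simp only [Set.mem_preimage, Set.mem_Iio, Set.mem_ofPred_eq]
        rw [← (key y).1.lt_iff_lt]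
        simp only [hg y]
      rw [this]
      have := hfy a
      exact isOpen_lt continuous_const (by fun_prop)
  refine ⟨g, ?_, ?_, ?_⟩
  · intro x y
    constructor
    · intro h
      exact (key y).1.injective (by simp only [hg y, h])
    · rintro rfl
      exact hg y
  · exact hc.comp (by fun_prop : Continuous fun y : ℝ => (g y, y))
  · intro y z hyz
    have a := hgm hyz
    have a1 := hFm a
    have e1 := hg y
    have e2 := hg z
    simp only
    linarith

lemma chain_aux (n : ℕ) : ∀ (f : Fin n → ℝ → ℝ → ℝ)
    (_ : ∀ i, Continuous fun p : ℝ × ℝ => f i p.1 p.2)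
    (_ : ∀ i w, Antitone fun v => f i v w)
    (_ : ∀ i v, Monotone fun w => f i v w)
    (F : ℝ → ℝ) (_ : Continuous F) (_ : Monotone F) (b : Fin (n + 1) → ℝ),
    ∃! W : Fin (n + 1) → ℝ, ∀ k : Fin (n + 1),
      W k + (if k = 0 then F (W 0) else 0)
        + (∑ i : Fin n, if k = i.succ then f i (W i.castSucc) (W i.succ) else 0)
        - (∑ i : Fin n, if k = i.castSucc then f i (W i.castSucc) (W i.succ) else 0) = b k := by
  induction n with
  | zero =>
    intro f _ _ _ F hFc hFm b
    obtain ⟨hs, hsur⟩ := one_dim_aux (fun x => x + F x) (by fun_prop)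
      (by intro u v h; have := hFm h; simp only; linarith)
    obtain ⟨x, hx⟩ := hsur (b 0)
    refine ⟨fun _ => x, ?_, ?_⟩
    · intro k
      have : k = 0 := Fin.eq_zero k
      subst this
      simpa using hx
    · intro V hV
      have h0 := hV 0
      simp at h0
      funext k
      have : k = 0 := Fin.eq_zero k
      subst this
      exact hs.injective (by simp only at hx ⊢; rw [hx, h0])
  | succ n ih =>
    intro f hc h1 h2 F hFc hFm b
    obtain ⟨g, hg, hgc, hgm⟩ := elim_aux F hFc hFm (f 0) (hc 0) (h1 0) (h2 0) (b 0)
    have IH := ih (fun i => f i.succ) (fun i => hc _) (fun i => h1 _) (fun i => h2 _)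
      (fun y => f 0 (g y) y) hgc hgm (fun j => b j.succ)
    have red : ∀ W : Fin (n + 2) → ℝ, (∀ k : Fin (n + 2),
      W k + (if k = 0 then F (W 0) else 0)
        + (∑ i : Fin (n+1), if k = i.succ then f i (W i.castSucc) (W i.succ) else 0)
        - (∑ i : Fin (n+1), if k = i.castSucc then f i (W i.castSucc) (W i.succ) else 0) = b k) ↔
      (W 0 = g (W 1) ∧ ∀ k : Fin (n + 1),
      W k.succ + (if k = 0 then f 0 (g (W 1)) (W 1) else 0)
        + (∑ i : Fin n, if k = i.succ then f i.succ (W i.castSucc.succ) (W i.succ.succ) else 0)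
        - (∑ i : Fin n, if k = i.castSucc then f i.succ (W i.castSucc.succ) (W i.succ.succ) else 0)
          = b k.succ) := by
      intro W
      rw [Fin.forall_fin_succ]
      have e0 : (W 0 + (if (0 : Fin (n+2)) = 0 then F (W 0) else 0)
        + (∑ i : Fin (n+1), if 0 = i.succ then f i (W i.castSucc) (W i.succ) else 0)
        - (∑ i : Fin (n+1), if 0 = i.castSucc then f i (W i.castSucc) (W i.succ) else 0) = b 0)
          ↔ W 0 = g (W 1) := by
        rw [← hg]
        have z : ∀ i : Fin (n+1), (0 : Fin (n+2)) ≠ i.succ := fun i => (Fin.succ_ne_zero i).symm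
        have z' : ∀ i : Fin n, (0 : Fin (n+2)) ≠ i.succ.castSucc := fun i => by
          rw [← Fin.succ_castSucc]; exact (Fin.succ_ne_zero _).symm
        rw [Fin.sum_univ_succ (fun i : Fin (n+1) => if (0 : Fin (n+2)) = i.castSucc then f i (W i.castSucc) (W i.succ) else 0)]
        simp [z]
      rw [e0]
      refine and_congr_right fun hW => forall_congr' fun k => ?_
      have z : ∀ i : Fin (n+1), i.succ ≠ (0 : Fin (n+2)) := fun i => Fin.succ_ne_zero i
      simp only [Fin.sum_univ_succ (n := n), Fin.succ_inj, ← Fin.succ_castSucc, Fin.castSucc_zero, z,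
        if_false, Fin.succ_zero_eq_one, ← hW]
      ring_nf
    obtain ⟨V, hV, hVu⟩ := IH
    refine ⟨Fin.cons (g (V 0)) V, ?_, ?_⟩
    · refine (red _).2 ⟨?_, ?_⟩
      · rw [← Fin.succ_zero_eq_one]; simp
      · intro k
        have := hV k
        rw [← Fin.succ_zero_eq_one]
        simpa using this
    · intro W hW
      obtain ⟨w0, w1⟩ := (red W).1 hW
      have : (fun j : Fin (n+1) => W j.succ) = V := hVu _ (by
        intro k
        have := w1 k
        rw [← Fin.succ_zero_eq_one] at this
        exact this)
      subst this
      funext k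
      refine Fin.cases ?_ (fun j => ?_) k
      · simpa using w0
      · simp

/-- Under the standing assumptions on the `f_i` (continuously
differentiable, strictly decreasing in the first argument, strictly increasing in the
second, `f_i(0,0) = 0`), for any vectors `U_{j-1}, U_j, U_{j+1} ∈ ℝ^r` and any
`Δt, Δx, ε > 0` there is a unique `W ∈ ℝ^r` solving the implicit equation of one time
step of the semi-implicit upwind scheme. -/
theorem stmt4 (m : ℕ) (f : Fin (m + 1) → ℝ → ℝ → ℝ)
    (hf1 : ∀ i, ContDiff ℝ 1 fun p : ℝ × ℝ => f i p.1 p.2)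
    (hf2 : ∀ i w, StrictAnti fun v => f i v w)
    (hf3 : ∀ i v, StrictMono fun w => f i v w)
    (hf0 : ∀ i, f i 0 0 = 0)
    (lam : Fin (m + 2) → ℝ) (Δt Δx ε : ℝ)
    (hΔt : 0 < Δt) (hΔx : 0 < Δx) (hε : 0 < ε)
    (Ujm Uj Ujp : Fin (m + 2) → ℝ) :
    ∃! W : Fin (m + 2) → ℝ, ∀ i : Fin (m + 2),
      (W i - Uj i) / Δt
        + (lam i + |lam i|) / 2 * (Uj i - Ujm i) / Δx
        + (lam i - |lam i|) / 2 * (Ujp i - Uj i) / Δx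
      = (1 / ε) * Qr m f W i := by
  have hd : 0 < Δt / ε := div_pos hΔt hε
  have key := chain_aux (m + 1) (fun i v w => Δt / ε * f i v w)
    (fun i => continuous_const.mul (hf1 i).continuous)
    (fun i w u v h => mul_le_mul_of_nonneg_left ((hf2 i w).antitone h) hd.le)
    (fun i w u v h => mul_le_mul_of_nonneg_left ((hf3 i w).monotone h) hd.le)
    (fun _ => 0) continuous_const monotone_const
    (fun i => Uj i - Δt * ((lam i + |lam i|) / 2 * (Uj i - Ujm i) / Δx
        + (lam i - |lam i|) / 2 * (Ujp i - Uj i) / Δx))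
  refine (existsUnique_congr fun W => forall_congr' fun i => ?_).1 key
  have e1 : ∀ p : Fin (m + 1) → Prop, ∀ [DecidablePred p], (∑ j, if p j then
      Δt / ε * f j (W j.castSucc) (W j.succ) else 0)
      = Δt / ε * ∑ j, if p j then f j (W j.castSucc) (W j.succ) else 0 := by
    intro p _
    rw [Finset.mul_sum]
    refine Finset.sum_congr rfl fun j _ => ?_
    split_ifs <;> simp
  simp only [Qr, e1, ite_self]
  generalize (∑ j : Fin (m + 1), if i = j.succ then f j (W j.castSucc) (W j.succ) else 0) = A
  generalize (∑ j : Fin (m + 1), if i = j.castSucc then f j (W j.castSucc) (W j.succ) else 0) = B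
  generalize (lam i + |lam i|) / 2 * (Uj i - Ujm i) / Δx = C
  generalize (lam i - |lam i|) / 2 * (Ujp i - Uj i) / Δx = D
  have hne := hΔt.ne'
  have hne2 := hε.ne'
  constructor
  · intro h
    have : W i - Uj i = Δt * (1 / ε * (B - A) - C - D) := by
      linear_combination h
    rw [this, mul_div_cancel_left₀ _ hne]
    ring
  · intro h
    have h2 : (W i - Uj i) / Δt = 1 / ε * (B - A) - C - D := by linear_combination h
    rw [div_eq_iff hne] at h2
    linear_combination h2
end

section
/- Let U, V : ℕ × ℤ → ℝ^r be two solutions of the semi-implicit upwind scheme with the same grid sizes Δt, Δx satisfying the CFL condition and the same ε > 0, and suppose ∑_{j∈ℤ} |U_j^0 − V_j^0| < ∞. Then for every n ≥ 0, ∑_{j∈ℤ} |U_j^n − V_j^n| ≤ ∑_{j∈ℤ} |U_j^0 − V_j^0|, where |·| is the 1-norm on ℝ^r. -/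
open scoped BigOperators

theorem cell_reaction (m : ℕ) (f : Fin (m + 1) → ℝ → ℝ → ℝ)
    (hf2 : ∀ i w, StrictAnti fun v => f i v w)
    (hf3 : ∀ i v, StrictMono fun w => f i v w) (u v : Fin (m + 2) → ℝ) :
    ∑ k, (SignType.sign (u k - v k) : ℝ) * (Qr m f u k - Qr m f v k) ≤ 0 := by
  have key : ∀ w : Fin (m + 2) → ℝ, ∀ s : Fin (m + 2) → ℝ, ∑ k, s k * Qr m f w k =
      ∑ i : Fin (m + 1), (s i.castSucc - s i.succ) * f i (w i.castSucc) (w i.succ) := by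
    intro w s
    simp only [Qr, mul_sub, Finset.sum_sub_distrib, Finset.mul_sum, sub_mul, mul_ite, mul_zero]
    congr 1
    · rw [Finset.sum_comm]
      simp
    · rw [Finset.sum_comm]
      simp
  simp only [mul_sub, Finset.sum_sub_distrib]
  rw [key u, key v, ← Finset.sum_sub_distrib]
  apply Finset.sum_nonpos
  intro i _
  rw [← mul_sub]
  have m2 : ∀ a b c, a ≤ b → f i b c ≤ f i a c := fun a b c h => (hf2 i c).antitone h
  have m3 : ∀ a b c, a ≤ b → f i c a ≤ f i c b := fun a b c h => (hf3 i c).monotone h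
  generalize u i.castSucc = a
  generalize u i.succ = b
  generalize v i.castSucc = c
  generalize v i.succ = d
  have pos : c ≤ a → b ≤ d → f i a b - f i c d ≤ 0 := by
    intro h1 h2
    linarith [m2 c a b h1, m3 b d c h2]
  have neg : a ≤ c → d ≤ b → 0 ≤ f i a b - f i c d := by
    intro h1 h2
    linarith [m2 a c b h1, m3 d b c h2]
  rcases lt_trichotomy (a - c) 0 with h | h | h <;>
  rcases lt_trichotomy (b - d) 0 with h' | h' | h' <;>
  simp [h, h'] <;>
  first
    | (have := pos (by linarith) (by linarith); linarith)
    | (have := neg (by linarith) (by linarith); linarith)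

theorem cell_bound (m : ℕ) (f : Fin (m + 1) → ℝ → ℝ → ℝ)
    (hf2 : ∀ i w, StrictAnti fun v => f i v w)
    (hf3 : ∀ i v, StrictMono fun w => f i v w) (u v W : Fin (m + 2) → ℝ) (c : ℝ) (hc : 0 ≤ c)
    (h : ∀ k, u k - v k = W k + c * (Qr m f u k - Qr m f v k)) :
    ∑ k, |u k - v k| ≤ ∑ k, |W k| := by
  have h1 := cell_reaction m f hf2 hf3 u v
  have h2 : ∀ k, |u k - v k| ≤
      |W k| + c * ((SignType.sign (u k - v k) : ℝ) * (Qr m f u k - Qr m f v k)) := by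
    intro k
    have e : |u k - v k| = (SignType.sign (u k - v k) : ℝ) * (u k - v k) :=
      (sign_mul_self _).symm
    have b : (SignType.sign (u k - v k) : ℝ) * W k ≤ |W k| := by
      rcases lt_trichotomy (u k - v k) 0 with h | h | h <;> simp [h]
      · exact neg_le_abs _
      · exact le_abs_self _
    have e2 : (SignType.sign (u k - v k) : ℝ) * (u k - v k) =
      (SignType.sign (u k - v k) : ℝ) * (W k + c * (Qr m f u k - Qr m f v k)) := by
      rw [← h k]
    rw [e, e2]
    linarith
  calc _ ≤ _ := Finset.sum_le_sum fun k _ => h2 k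
    _ = ∑ k, |W k| + c * ∑ k, (SignType.sign (u k - v k) : ℝ) * (Qr m f u k - Qr m f v k) := by
      rw [Finset.sum_add_distrib, Finset.mul_sum]
    _ ≤ _ := by nlinarith

/-- **L¹-stability.** Let `U, V` be two solutions of the semi-implicit
upwind scheme with the same grid sizes `Δt, Δx` satisfying the CFL condition and the
same `ε > 0`, with `∑_{j ∈ ℤ} |U_j^0 - V_j^0| < ∞`.  Then for every `n ≥ 0`,
`∑_{j ∈ ℤ} |U_j^n - V_j^n| ≤ ∑_{j ∈ ℤ} |U_j^0 - V_j^0|` (1-norms on `ℝ^r`). -/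
theorem stmt5 (m : ℕ) (f : Fin (m + 1) → ℝ → ℝ → ℝ)
    (hf1 : ∀ i, ContDiff ℝ 1 fun p : ℝ × ℝ => f i p.1 p.2)
    (hf2 : ∀ i w, StrictAnti fun v => f i v w)
    (hf3 : ∀ i v, StrictMono fun w => f i v w)
    (hf0 : ∀ i, f i 0 0 = 0)
    (lam : Fin (m + 2) → ℝ) (Δt Δx ε : ℝ)
    (hΔt : 0 < Δt) (hΔx : 0 < Δx) (hε : 0 < ε)
    (hCFL : CFL m lam Δt Δx)
    (U V : ℕ → ℤ → Fin (m + 2) → ℝ)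
    (hU : Scheme m f lam Δt Δx ε U) (hV : Scheme m f lam Δt Δx ε V)
    (hsum : Summable fun j : ℤ => onenorm (U 0 j - V 0 j)) :
    ∀ n : ℕ, Summable (fun j : ℤ => onenorm (U n j - V n j)) ∧
      ∑' j : ℤ, onenorm (U n j - V n j) ≤ ∑' j : ℤ, onenorm (U 0 j - V 0 j) := by
  intro n
  induction n with
  | zero => exact ⟨hsum, le_rfl⟩
  | succ n ih =>
    obtain ⟨hs, hle⟩ := ih
    set D : ℤ → Fin (m + 2) → ℝ := fun j i => |U n j i - V n j i| with hD
    have hDs : ∀ i, Summable fun j => D j i := by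
      intro i
      refine Summable.of_nonneg_of_le (fun j => abs_nonneg _) (fun j => ?_) hs
      exact Finset.single_le_sum (f := fun i => |(U n j - V n j) i|)
        (fun i _ => abs_nonneg _) (Finset.mem_univ i)
    set p : Fin (m + 2) → ℝ := fun i => Δt / Δx * ((lam i + |lam i|) / 2) with hp
    set q : Fin (m + 2) → ℝ := fun i => Δt / Δx * ((|lam i| - lam i) / 2) with hq
    have hτ : 0 < Δt / Δx := div_pos hΔt hΔx
    have hp0 : ∀ i, 0 ≤ p i := fun i =>
      mul_nonneg hτ.le (by linarith [neg_abs_le (lam i)])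
    have hq0 : ∀ i, 0 ≤ q i := fun i =>
      mul_nonneg hτ.le (by linarith [le_abs_self (lam i)])
    have hpq : ∀ i, 0 ≤ 1 - p i - q i := by
      intro i
      have := hCFL i
      have e : p i + q i = Δt / Δx * |lam i| := by simp only [hp, hq]; ring
      linarith
    have hB : HasSum (fun j => ∑ i, ((1 - p i - q i) * D j i + p i * D (j - 1) i
        + q i * D (j + 1) i)) (∑ i, ∑' j, D j i) := by
      apply hasSum_sum
      intro i _
      have h0 := (hDs i).hasSum
      have h1 : HasSum (fun j => D (j - 1) i) (∑' j, D j i) :=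
        (Equiv.hasSum_iff (Equiv.subRight (1 : ℤ))).2 h0
      have h2 : HasSum (fun j => D (j + 1) i) (∑' j, D j i) :=
        (Equiv.hasSum_iff (Equiv.addRight (1 : ℤ))).2 h0
      have := ((h0.mul_left (1 - p i - q i)).add (h1.mul_left (p i))).add (h2.mul_left (q i))
      have e : ∀ S : ℝ, (1 - p i - q i) * S + p i * S + q i * S = S := fun S => by ring
      rw [e] at this
      exact this
    have hT : HasSum (fun j => onenorm (U n j - V n j)) (∑ i, ∑' j, D j i) :=
      hasSum_sum fun i _ => (hDs i).hasSum
    have hstep : ∀ j, onenorm (U (n + 1) j - V (n + 1) j) ≤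
        ∑ i, ((1 - p i - q i) * D j i + p i * D (j - 1) i + q i * D (j + 1) i) := by
      intro j
      refine (cell_bound m f hf2 hf3 (U (n + 1) j) (V (n + 1) j)
        (fun i => (1 - p i - q i) * (U n j i - V n j i)
          + p i * (U n (j - 1) i - V n (j - 1) i) + q i * (U n (j + 1) i - V n (j + 1) i))
        (Δt / ε) (div_pos hΔt hε).le ?_).trans ?_
      · intro i
        have a := hU n j i
        have b := hV n j i
        have a' : Δt * (1 / ε * Qr m f (U (n + 1) j) i) = _ := congrArg (Δt * ·) a.symm
        have b' : Δt * (1 / ε * Qr m f (V (n + 1) j) i) = _ := congrArg (Δt * ·) b.symm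
        have e : Δt / ε * (Qr m f (U (n + 1) j) i - Qr m f (V (n + 1) j) i) =
          Δt * (1 / ε * Qr m f (U (n + 1) j) i) - Δt * (1 / ε * Qr m f (V (n + 1) j) i) := by
          ring
        rw [e, a', b']
        simp only [hp, hq]
        field_simp
        ring
      · apply Finset.sum_le_sum
        intro i _
        refine (abs_add_three _ _ _).trans ?_
        rw [abs_mul (1 - p i - q i), abs_mul (p i), abs_mul (q i), abs_of_nonneg (hp0 i), abs_of_nonneg (hq0 i),
          abs_of_nonneg (hpq i)]
    have hnn : ∀ j, 0 ≤ onenorm (U (n + 1) j - V (n + 1) j) :=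
      fun j => Finset.sum_nonneg fun i _ => abs_nonneg _
    have hs' := Summable.of_nonneg_of_le hnn hstep hB.summable
    refine ⟨hs', le_trans ?_ hle⟩
    rw [hT.tsum_eq, ← hB.tsum_eq]
    exact hs'.tsum_le_tsum hstep hB.summable
end

section
/- Let U : ℕ × ℤ → ℝ^r be a solution of the semi-implicit upwind scheme with grid sizes satisfying the CFL condition, and suppose the initial total variation ∑_{j∈ℤ} |U_j^0 − U_{j−1}^0| is finite. Then for every n ≥ 0, ∑_{j∈ℤ} |U_j^n − U_{j−1}^n| ≤ ∑_{j∈ℤ} |U_j^0 − U_{j−1}^0|, where |·| is the 1-norm on ℝ^r. -/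
open scoped BigOperators

theorem aux_Q (m : ℕ) (f : Fin (m + 1) → ℝ → ℝ → ℝ)
    (hf2 : ∀ i w, StrictAnti fun v => f i v w)
    (hf3 : ∀ i v, StrictMono fun w => f i v w)
    (A B : Fin (m + 2) → ℝ) :
    ∑ k, SignType.sign (A k - B k) * (Qr m f A k - Qr m f B k) ≤ (0 : ℝ) := by
  have key : ∀ (s C : Fin (m + 2) → ℝ), ∑ k, s k * Qr m f C k
      = ∑ i : Fin (m + 1), (s i.castSucc - s i.succ) * f i (C i.castSucc) (C i.succ) := by
    intro s C
    simp only [Qr, mul_sub, Finset.sum_sub_distrib, Finset.mul_sum, sub_mul]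
    congr 1
    · rw [Finset.sum_comm]
      simp
    · rw [Finset.sum_comm]
      simp
  simp only [mul_sub, Finset.sum_sub_distrib]
  rw [key, key, ← Finset.sum_sub_distrib]
  apply Finset.sum_nonpos
  intro i _
  rw [← mul_sub]
  have mono : ∀ a b c d : ℝ, b ≤ a → c ≤ d → f i a c ≤ f i b d := fun a b c d h1 h2 =>
    ((hf2 i c).antitone h1).trans ((hf3 i b).monotone h2)
  have h1 := mono (A i.castSucc) (B i.castSucc) (A i.succ) (B i.succ)
  have h2 := mono (B i.castSucc) (A i.castSucc) (B i.succ) (A i.succ)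
  rcases lt_trichotomy (A i.castSucc - B i.castSucc) 0 with h | h | h <;>
  rcases lt_trichotomy (A i.succ - B i.succ) 0 with h' | h' | h' <;>
  simp only [sign_neg, sign_pos, h, h', sign_zero, SignType.coe_zero, SignType.coe_one,
    SignType.coe_neg_one] <;>
  first
  | (have := h1 (by linarith) (by linarith); linarith)
  | (have := h2 (by linarith) (by linarith); linarith)
  | linarith

theorem aux_pt (m : ℕ) (f : Fin (m + 1) → ℝ → ℝ → ℝ)
    (hf2 : ∀ i w, StrictAnti fun v => f i v w)
    (hf3 : ∀ i v, StrictMono fun w => f i v w)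
    (c : ℝ) (hc : 0 ≤ c) (A B R : Fin (m + 2) → ℝ)
    (h : ∀ k, A k - B k = R k + c * (Qr m f A k - Qr m f B k)) :
    onenorm (A - B) ≤ ∑ k, |R k| := by
  have h1 : onenorm (A - B) = ∑ k, SignType.sign (A k - B k) * R k
      + c * ∑ k, SignType.sign (A k - B k) * (Qr m f A k - Qr m f B k) := by
    rw [Finset.mul_sum, ← Finset.sum_add_distrib]
    apply Finset.sum_congr rfl
    intro k _
    rw [Pi.sub_apply, ← sign_mul_self]
    nth_rw 2 [h k]
    ring
  have h2 := mul_nonpos_of_nonneg_of_nonpos hc (aux_Q m f hf2 hf3 A B)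
  have h3 : ∑ k, SignType.sign (A k - B k) * R k ≤ ∑ k, |R k| := by
    apply Finset.sum_le_sum
    intro k _
    rcases lt_trichotomy (A k - B k) 0 with h | h | h <;>
    simp [sign_neg, sign_pos, h, neg_le_abs, le_abs_self]
  linarith

theorem aux_step (m : ℕ) (f : Fin (m + 1) → ℝ → ℝ → ℝ)
    (hf2 : ∀ i w, StrictAnti fun v => f i v w)
    (hf3 : ∀ i v, StrictMono fun w => f i v w)
    (lam : Fin (m + 2) → ℝ) (Δt Δx ε : ℝ)
    (hΔt : 0 < Δt) (hΔx : 0 < Δx) (hε : 0 < ε)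
    (hCFL : CFL m lam Δt Δx)
    (U : ℕ → ℤ → Fin (m + 2) → ℝ)
    (hU : Scheme m f lam Δt Δx ε U) (n : ℕ)
    (hsum : Summable fun j : ℤ => onenorm (U n j - U n (j - 1))) :
    Summable (fun j : ℤ => onenorm (U (n + 1) j - U (n + 1) (j - 1))) ∧
      ∑' j : ℤ, onenorm (U (n + 1) j - U (n + 1) (j - 1))
        ≤ ∑' j : ℤ, onenorm (U n j - U n (j - 1)) := by
  set μ := Δt / Δx with hμ
  have hμ0 : 0 < μ := div_pos hΔt hΔx
  let v : Fin (m + 2) → ℤ → ℝ := fun k j => U n j k - U n (j - 1) k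
  let p : Fin (m + 2) → ℝ := fun k => μ * ((|lam k| + lam k) / 2)
  let q : Fin (m + 2) → ℝ := fun k => μ * ((|lam k| - lam k) / 2)
  have hp : ∀ k, 0 ≤ p k := fun k => mul_nonneg hμ0.le (by linarith [neg_abs_le (lam k)])
  have hq : ∀ k, 0 ≤ q k := fun k => mul_nonneg hμ0.le (by linarith [le_abs_self (lam k)])
  have hpq : ∀ k, 0 ≤ 1 - p k - q k := fun k => by
    have : μ * |lam k| ≤ 1 := hCFL k
    simp only [p, q]
    linarith
  have hv : ∀ k, Summable fun j => |v k j| := fun k => by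
    refine Summable.of_nonneg_of_le (fun _ => abs_nonneg _) (fun j => ?_) hsum
    exact Finset.single_le_sum (f := fun i => |(U n j - U n (j - 1)) i|)
      (fun i _ => abs_nonneg _) (Finset.mem_univ k)
  let G : ℤ → ℝ := fun j => ∑ k, ((1 - p k - q k) * |v k j| + p k * |v k (j - 1)|
    + q k * |v k (j + 1)|)
  have hG : HasSum G (∑ k, ∑' j, |v k j|) := by
    apply hasSum_sum
    intro k _
    have a0 := (hv k).hasSum
    have a1 : HasSum (fun j : ℤ => |v k (j - 1)|) (∑' j, |v k j|) :=
      (Equiv.subRight (1 : ℤ)).hasSum_iff.mpr a0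
    have a2 : HasSum (fun j : ℤ => |v k (j + 1)|) (∑' j, |v k j|) :=
      (Equiv.addRight (1 : ℤ)).hasSum_iff.mpr a0
    have a3 := ((a0.mul_left (1 - p k - q k)).add (a1.mul_left (p k))).add (a2.mul_left (q k))
    have e : ∀ a b S : ℝ, (1 - a - b) * S + a * S + b * S = S := fun a b S => by ring
    rw [e] at a3
    exact a3
  have hT : HasSum (fun j : ℤ => onenorm (U n j - U n (j - 1))) (∑ k, ∑' j, |v k j|) :=
    hasSum_sum fun k _ => (hv k).hasSum
  have hle : ∀ j : ℤ, onenorm (U (n + 1) j - U (n + 1) (j - 1)) ≤ G j := by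
    intro j
    refine (aux_pt m f hf2 hf3 (Δt / ε) (by positivity) _ _
      (fun k => (1 - p k - q k) * v k j + p k * v k (j - 1) + q k * v k (j + 1)) ?_).trans ?_
    · intro k
      have e : ∀ j, U (n + 1) j k = U n j k - p k * (U n j k - U n (j - 1) k)
          + q k * (U n (j + 1) k - U n j k) + Δt / ε * Qr m f (U (n + 1) j) k := by
        intro j
        have := hU n j k
        simp only [p, q, hμ]
        field_simp at this ⊢
        linarith
      rw [e j, e (j - 1)]
      simp only [v, sub_add_cancel, add_sub_cancel_right]
      ring
    · apply Finset.sum_le_sum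
      intro k _
      refine (abs_add_three _ _ _).trans ?_
      rw [abs_mul (1 - p k - q k), abs_mul (p k), abs_mul (q k), abs_of_nonneg (hp k),
        abs_of_nonneg (hq k), abs_of_nonneg (hpq k)]
  have hS : Summable (fun j : ℤ => onenorm (U (n + 1) j - U (n + 1) (j - 1))) :=
    Summable.of_nonneg_of_le (fun j => Finset.sum_nonneg fun _ _ => abs_nonneg _) hle hG.summable
  refine ⟨hS, ?_⟩
  rw [hT.tsum_eq, ← hG.tsum_eq]
  exact hS.tsum_le_tsum hle hG.summable

/-- **BV-estimate.** Let `U` solve the semi-implicit upwind scheme with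
grid sizes satisfying the CFL condition and finite initial total variation
`∑_{j ∈ ℤ} |U_j^0 - U_{j-1}^0|`.  Then for every `n ≥ 0`,
`∑_{j ∈ ℤ} |U_j^n - U_{j-1}^n| ≤ ∑_{j ∈ ℤ} |U_j^0 - U_{j-1}^0|` (1-norms on `ℝ^r`). -/
theorem stmt6 (m : ℕ) (f : Fin (m + 1) → ℝ → ℝ → ℝ)
    (hf1 : ∀ i, ContDiff ℝ 1 fun p : ℝ × ℝ => f i p.1 p.2)
    (hf2 : ∀ i w, StrictAnti fun v => f i v w)
    (hf3 : ∀ i v, StrictMono fun w => f i v w)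
    (hf0 : ∀ i, f i 0 0 = 0)
    (lam : Fin (m + 2) → ℝ) (Δt Δx ε : ℝ)
    (hΔt : 0 < Δt) (hΔx : 0 < Δx) (hε : 0 < ε)
    (hCFL : CFL m lam Δt Δx)
    (U : ℕ → ℤ → Fin (m + 2) → ℝ)
    (hU : Scheme m f lam Δt Δx ε U)
    (hsum : Summable fun j : ℤ => onenorm (U 0 j - U 0 (j - 1))) :
    ∀ n : ℕ, Summable (fun j : ℤ => onenorm (U n j - U n (j - 1))) ∧
      ∑' j : ℤ, onenorm (U n j - U n (j - 1))
        ≤ ∑' j : ℤ, onenorm (U 0 j - U 0 (j - 1)) := by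
  intro n
  induction n with
  | zero => exact ⟨hsum, le_rfl⟩
  | succ n ih =>
    have := aux_step m f hf2 hf3 lam Δt Δx ε hΔt hΔx hε hCFL U hU n ih.1
    exact ⟨this.1, this.2.trans ih.2⟩
end

section
/- Let U : ℕ × ℤ → ℝ^r be a solution of the semi-implicit upwind scheme with grid sizes satisfying the CFL condition, with initial total variation ∑_{j∈ℤ} |U_j^0 − U_{j−1}^0| finite, and suppose there is an integer J₀ such that U_j^0 = 0 for all j > J₀. Then for every n ≥ 0 and every j ∈ ℤ, |U_j^n| ≤ ∑_{k∈ℤ} |U_k^0 − U_{k−1}^0|, where |·| is the 1-norm on ℝ^r. -/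
open scoped BigOperators

lemma sum_mul_Qr (m : ℕ) (f : Fin (m + 1) → ℝ → ℝ → ℝ) (V s : Fin (m + 2) → ℝ) :
    ∑ k, s k * Qr m f V k
      = ∑ i : Fin (m + 1), (s i.castSucc - s i.succ) * f i (V i.castSucc) (V i.succ) := by
  unfold Qr
  simp only [mul_sub, Finset.mul_sum, Finset.sum_sub_distrib, mul_ite, mul_zero, sub_mul]
  congr 1
  · rw [Finset.sum_comm]
    simp
  · rw [Finset.sum_comm]
    simp

lemma sgn_mul_f (g : ℝ → ℝ → ℝ) (h2 : ∀ w, StrictAnti fun v => g v w)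
    (h3 : ∀ v, StrictMono fun w => g v w) (a b a' b' : ℝ) :
    (Real.sign (a - a') - Real.sign (b - b')) * (g a b - g a' b') ≤ 0 := by
  have down : a' ≤ a → b ≤ b' → g a b ≤ g a' b' := fun h h' =>
    le_trans ((h2 b).antitone h) ((h3 a').monotone h')
  have up : a ≤ a' → b' ≤ b → g a' b' ≤ g a b := fun h h' =>
    le_trans ((h2 b').antitone h) ((h3 a).monotone h')
  rcases lt_trichotomy (a - a') 0 with h | h | h <;>
  rcases lt_trichotomy (b - b') 0 with h' | h' | h' <;>
  simp only [Real.sign_of_neg, Real.sign_of_pos, Real.sign_zero, h, h'] <;>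
  first
    | (have := down (by linarith) (by linarith); linarith)
    | (have := up (by linarith) (by linarith); linarith)
    | linarith

lemma sign_mul_le (x y : ℝ) : Real.sign x * y ≤ |y| := by
  rcases Real.sign_apply_eq x with h | h | h <;> rw [h]
  · linarith [neg_abs_le y]
  · simp
  · linarith [le_abs_self y]

lemma sign_mul_self' (x : ℝ) : Real.sign x * x = |x| := by
  rcases lt_trichotomy x 0 with h | h | h
  · rw [Real.sign_of_neg h, abs_of_neg h]; ring
  · simp [h]
  · rw [Real.sign_of_pos h, abs_of_pos h]; ring

lemma contraction (m : ℕ) (f : Fin (m + 1) → ℝ → ℝ → ℝ)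
    (hf2 : ∀ i w, StrictAnti fun v => f i v w)
    (hf3 : ∀ i v, StrictMono fun w => f i v w)
    (a : ℝ) (ha : 0 ≤ a) (V V' W W' : Fin (m + 2) → ℝ)
    (h : ∀ i, V i = W i + a * Qr m f V i) (h' : ∀ i, V' i = W' i + a * Qr m f V' i) :
    ∑ i, |V i - V' i| ≤ ∑ i, |W i - W' i| := by
  set s : Fin (m + 2) → ℝ := fun i => Real.sign (V i - V' i) with hs
  have e : ∑ i, |V i - V' i| = ∑ i, s i * (W i - W' i)
      + a * (∑ i, s i * Qr m f V i - ∑ i, s i * Qr m f V' i) := by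
    rw [← Finset.sum_sub_distrib, Finset.mul_sum, ← Finset.sum_add_distrib]
    refine Finset.sum_congr rfl fun i _ => ?_
    rw [← sign_mul_self']
    change s i * _ = _
    linear_combination s i * (h i) - s i * (h' i)
  have q : ∑ i, s i * Qr m f V i - ∑ i, s i * Qr m f V' i ≤ 0 := by
    rw [sum_mul_Qr, sum_mul_Qr, ← Finset.sum_sub_distrib]
    refine Finset.sum_nonpos fun i _ => ?_
    rw [← mul_sub]
    exact sgn_mul_f (f i) (hf2 i) (hf3 i) _ _ _ _
  have w : ∑ i, s i * (W i - W' i) ≤ ∑ i, |W i - W' i| :=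
    Finset.sum_le_sum fun i _ => sign_mul_le _ _
  nlinarith [mul_nonneg ha (neg_nonneg.2 q)]

lemma comp_le_sum {r : ℕ} (g : Fin r → ℝ) (hg : ∀ i, 0 ≤ g i) (i : Fin r) :
    g i ≤ ∑ i, g i :=
  Finset.single_le_sum (fun i _ => hg i) (Finset.mem_univ i)

lemma telescope (u : ℤ → ℝ) (hs : Summable fun j : ℤ => |u j - u (j - 1)|)
    (N : ℤ) (hN : ∀ j > N, u j = 0) (j : ℤ) : |u j| ≤ ∑' k : ℤ, |u k - u (k - 1)| := by
  have key : ∀ p : ℕ, |u j| ≤ |u (j + p)|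
      + ∑ q ∈ Finset.range p, |u (j + 1 + q) - u (j + 1 + q - 1)| := by
    intro p
    induction p with
    | zero => simp
    | succ p ih =>
      rw [Finset.sum_range_succ]
      have e1 : j + 1 + (p : ℤ) - 1 = j + p := by ring
      have e2 : j + ((p + 1 : ℕ) : ℤ) = j + 1 + p := by push_cast; ring
      rw [e1, e2]
      have := abs_sub_abs_le_abs_sub (u (j + p)) (u (j + 1 + p))
      rw [abs_sub_comm] at this
      linarith
  have h1 := key (N + 1 - j).toNat
  rw [hN (j + ((N + 1 - j).toNat : ℤ)) (by omega)] at h1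
  have h2 := hs.sum_le_tsum
    ((Finset.range (N + 1 - j).toNat).image fun q : ℕ => j + 1 + (q : ℤ))
    (fun _ _ => abs_nonneg _)
  rw [Finset.sum_image (by intro x _ y _ hxy; simpa using hxy)] at h2
  simp only [abs_zero, zero_add] at h1
  exact h1.trans h2

set_option maxHeartbeats 1000000 in
/-- **uniform boundedness.** Let `U` solve the semi-implicit upwind scheme
with grid sizes satisfying the CFL condition, with finite initial total variation, and
with `U_j^0 = 0` for all `j > J₀`.  Then for every `n ≥ 0` and `j ∈ ℤ`,
`|U_j^n| ≤ ∑_{k ∈ ℤ} |U_k^0 - U_{k-1}^0|` (1-norms on `ℝ^r`). -/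
theorem stmt7 (m : ℕ) (f : Fin (m + 1) → ℝ → ℝ → ℝ)
    (hf1 : ∀ i, ContDiff ℝ 1 fun p : ℝ × ℝ => f i p.1 p.2)
    (hf2 : ∀ i w, StrictAnti fun v => f i v w)
    (hf3 : ∀ i v, StrictMono fun w => f i v w)
    (hf0 : ∀ i, f i 0 0 = 0)
    (lam : Fin (m + 2) → ℝ) (Δt Δx ε : ℝ)
    (hΔt : 0 < Δt) (hΔx : 0 < Δx) (hε : 0 < ε)
    (hCFL : CFL m lam Δt Δx)
    (U : ℕ → ℤ → Fin (m + 2) → ℝ)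
    (hU : Scheme m f lam Δt Δx ε U)
    (hsum : Summable fun j : ℤ => onenorm (U 0 j - U 0 (j - 1)))
    (J₀ : ℤ) (hJ₀ : ∀ j > J₀, U 0 j = 0) :
    ∀ (n : ℕ) (j : ℤ),
      onenorm (U n j) ≤ ∑' k : ℤ, onenorm (U 0 k - U 0 (k - 1)) := by
  set p : Fin (m + 2) → ℝ := fun i => Δt / Δx * ((|lam i| + lam i) / 2) with hp
  set q : Fin (m + 2) → ℝ := fun i => Δt / Δx * ((|lam i| - lam i) / 2) with hq
  have hr : 0 < Δt / Δx := div_pos hΔt hΔx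
  have hp0 : ∀ i, 0 ≤ p i := fun i =>
    mul_nonneg hr.le (by linarith [neg_abs_le (lam i)])
  have hq0 : ∀ i, 0 ≤ q i := fun i =>
    mul_nonneg hr.le (by linarith [le_abs_self (lam i)])
  have hpq : ∀ i, 0 ≤ 1 - p i - q i := fun i => by
    have := hCFL i
    have e : p i + q i = Δt / Δx * |lam i| := by simp only [hp, hq]; ring
    linarith
  set W : ℕ → ℤ → Fin (m + 2) → ℝ := fun n j i =>
    (1 - p i - q i) * U n j i + p i * U n (j - 1) i + q i * U n (j + 1) i with hW
  have hV : ∀ n j i, U (n + 1) j i = W n j i + Δt / ε * Qr m f (U (n + 1) j) i := by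
    intro n j i
    have h := hU n j i
    have h2 : Δt / ε * Qr m f (U (n + 1) j) i
        = Δt * ((1 / ε) * Qr m f (U (n + 1) j) i) := by ring
    rw [h2, ← h]
    simp only [hW, hp, hq]
    field_simp
    ring
  clear_value W
  clear_value p q
  have ha : 0 ≤ Δt / ε := (div_pos hΔt hε).le
  have hQ0 : ∀ i, Qr m f 0 i = 0 := by
    intro i
    simp [Qr, hf0]
  have main : ∀ n : ℕ, (∀ i, Summable fun j : ℤ => |U n j i - U n (j - 1) i|) ∧
      ∑ i, ∑' j : ℤ, |U n j i - U n (j - 1) i| ≤ ∑' k : ℤ, onenorm (U 0 k - U 0 (k - 1)) ∧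
      ∀ j > J₀ + n, U n j = 0 := by
    intro n
    induction n with
    | zero =>
      have hs : ∀ i, Summable fun j : ℤ => |U 0 j i - U 0 (j - 1) i| := fun i =>
        Summable.of_nonneg_of_le (fun _ => abs_nonneg _) (fun j => by
          simpa [onenorm] using Finset.single_le_sum (s := Finset.univ)
            (f := fun i => |U 0 j i - U 0 (j - 1) i|)
            (fun _ _ => abs_nonneg _) (Finset.mem_univ i)) hsum
      refine ⟨hs, ?_, fun j hj => hJ₀ j (by simpa using hj)⟩
      rw [← Summable.tsum_finsetSum (fun i _ => hs i)]
      simp [onenorm]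
    | succ n ih =>
      obtain ⟨hs, hle, hz⟩ := ih
      set D : Fin (m + 2) → ℤ → ℝ := fun i j => |U n j i - U n (j - 1) i| with hD
      set G : Fin (m + 2) → ℤ → ℝ := fun i j =>
        (1 - p i - q i) * D i j + p i * D i (j - 1) + q i * D i (j + 1) with hG
      have hGs : ∀ i, HasSum (G i) (∑' j, D i j) := by
        intro i
        have h0 : HasSum (D i) (∑' j, D i j) := (hs i).hasSum
        have h1 : HasSum (fun j => D i (j - 1)) (∑' j, D i j) :=
          (Equiv.subRight (1 : ℤ)).hasSum_iff.2 h0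
        have h2 : HasSum (fun j => D i (j + 1)) (∑' j, D i j) :=
          (Equiv.addRight (1 : ℤ)).hasSum_iff.2 h0
        have := ((h0.mul_left (1 - p i - q i)).add (h1.mul_left (p i))).add
          (h2.mul_left (q i))
        have e : (1 - p i - q i) * (∑' j, D i j) + p i * (∑' j, D i j)
            + q i * (∑' j, D i j) = ∑' j, D i j := by ring
        rw [e] at this
        exact this
      have hWG : ∀ i j, |W n j i - W n (j - 1) i| ≤ G i j := by
        intro i j
        have e : W n j i - W n (j - 1) i = (1 - p i - q i) * (U n j i - U n (j - 1) i)
            + p i * (U n (j - 1) i - U n (j - 1 - 1) i)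
            + q i * (U n (j + 1) i - U n (j + 1 - 1) i) := by
          simp only [hW, sub_add_cancel, add_sub_cancel_right]
          ring
        rw [e]
        refine (abs_add_three _ _ _).trans ?_
        rw [abs_mul, abs_mul, abs_mul, abs_of_nonneg (hpq i), abs_of_nonneg (hp0 i),
          abs_of_nonneg (hq0 i)]
      change ∑ i, ∑' j : ℤ, D i j ≤ _ at hle
      clear_value G
      clear_value D
      have hc : ∀ j, ∑ i, |U (n + 1) j i - U (n + 1) (j - 1) i| ≤ ∑ i, G i j := fun j =>
        (contraction m f hf2 hf3 _ ha _ _ _ _ (hV n j) (hV n (j - 1))).trans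
          (Finset.sum_le_sum fun i _ => hWG i j)
      have hGsum : HasSum (fun j => ∑ i, G i j) (∑ i, ∑' j, D i j) :=
        hasSum_sum fun i _ => hGs i
      have hs' : ∀ i, Summable fun j : ℤ => |U (n + 1) j i - U (n + 1) (j - 1) i| := fun i =>
        Summable.of_nonneg_of_le (fun _ => abs_nonneg _) (fun j =>
          (comp_le_sum (fun i => |U (n + 1) j i - U (n + 1) (j - 1) i|)
            (fun _ => abs_nonneg _) i).trans (hc j)) hGsum.summable
      refine ⟨hs', ?_, ?_⟩
      · rw [← Summable.tsum_finsetSum (fun i _ => hs' i)]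
        refine le_trans ?_ hle
        rw [← hGsum.tsum_eq]
        exact Summable.tsum_le_tsum hc (summable_sum fun i _ => hs' i) hGsum.summable
      · intro j hj
        push_cast at hj
        have hW0 : ∀ i, W n j i = 0 := by
          intro i
          simp only [hW, hz j (by omega), hz (j - 1) (by omega), hz (j + 1) (by omega)]
          simp
        have := contraction m f hf2 hf3 _ ha (U (n + 1) j) 0 (W n j) 0 (hV n j)
          (fun i => by simp [hQ0])
        simp only [hW0, Pi.zero_apply, sub_zero, abs_zero, Finset.sum_const_zero] at this
        have h0 := (Finset.sum_eq_zero_iff_of_nonneg (fun i _ => abs_nonneg _)).1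
          (le_antisymm this (Finset.sum_nonneg fun i _ => abs_nonneg _))
        ext i
        simpa using h0 i (Finset.mem_univ i)
  intro n j
  obtain ⟨hs, hle, hz⟩ := main n
  refine le_trans ?_ hle
  exact Finset.sum_le_sum fun i _ =>
    telescope (fun j => U n j i) (hs i) (J₀ + n) (fun j hj => by simp [hz j hj]) j
end

section
/- Let A₁, A₂ < 0 and B₁, B₂ > 0 be real numbers and let M be the 2×2 matrix with rows (A₁−B₁, B₁) and (−A₂, A₂−B₂). Set A = B₁−A₁+B₂−A₂, B = B₁B₂ − A₁B₂ + A₁A₂, a = max{B₁+B₂−A₂, B₁−A₁−A₂}, and λ = min{A−a, B/a}. Then 0 < a < A, B > 0, λ > 0, and for every μ > 0 the matrix I − μM is invertible with ∞-norm of its inverse equal to (1 + aμ)/(1 + Aμ + Bμ²), which is at most (1 + λμ)^{−1}. -/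
open scoped BigOperators

/-- Let `A₁, A₂ < 0` and `B₁, B₂ > 0`, let `M` be the `2 × 2` matrix with
rows `(A₁ - B₁, B₁)` and `(-A₂, A₂ - B₂)`, and set `A = B₁ - A₁ + B₂ - A₂`,
`B = B₁B₂ - A₁B₂ + A₁A₂`, `a = max {B₁ + B₂ - A₂, B₁ - A₁ - A₂}`, `λ = min {A - a, B/a}`.
Then `0 < a < A`, `B > 0`, `λ > 0`, and for every `μ > 0` the matrix `I - μM` is invertible
with ∞-norm (maximum row absolute sum) of its inverse equal to
`(1 + aμ)/(1 + Aμ + Bμ²) ≤ (1 + λμ)⁻¹`. -/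
theorem stmt8 (A₁ A₂ B₁ B₂ : ℝ) (hA₁ : A₁ < 0) (hA₂ : A₂ < 0)
    (hB₁ : 0 < B₁) (hB₂ : 0 < B₂)
    (M : Matrix (Fin 2) (Fin 2) ℝ)
    (hM : M = !![A₁ - B₁, B₁; -A₂, A₂ - B₂])
    (A B a lam : ℝ)
    (hA : A = B₁ - A₁ + B₂ - A₂)
    (hB : B = B₁ * B₂ - A₁ * B₂ + A₁ * A₂)
    (ha : a = max (B₁ + B₂ - A₂) (B₁ - A₁ - A₂))
    (hlam : lam = min (A - a) (B / a)) :
    0 < a ∧ a < A ∧ 0 < B ∧ 0 < lam ∧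
    ∀ μ : ℝ, 0 < μ →
      IsUnit (1 - μ • M) ∧
      (⨆ k : Fin 2, ∑ l, |(1 - μ • M)⁻¹ k l|)
        = (1 + a * μ) / (1 + A * μ + B * μ ^ 2) ∧
      (1 + a * μ) / (1 + A * μ + B * μ ^ 2) ≤ (1 + lam * μ)⁻¹ := by
  have ha1 : B₁ + B₂ - A₂ ≤ a := ha ▸ le_max_left _ _
  have ha2 : B₁ - A₁ - A₂ ≤ a := ha ▸ le_max_right _ _
  have ha0 : 0 < a := by linarith
  have haA : a < A := by
    rw [ha, hA]; apply max_lt <;> linarith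
  have hB0 : 0 < B := by
    rw [hB]; nlinarith [mul_pos hB₁ hB₂, mul_pos_of_neg_of_neg hA₁ hA₂, mul_pos (neg_pos.2 hA₁) hB₂]
  have hl0 : 0 < lam := by
    rw [hlam]; exact lt_min (by linarith) (div_pos hB0 ha0)
  refine ⟨ha0, haA, hB0, hl0, fun μ hμ => ?_⟩
  have hD : 0 < 1 + A * μ + B * μ ^ 2 := by
    have : 0 < A := ha0.trans haA
    positivity
  have hN : 1 - μ • M = !![1 + μ * (B₁ - A₁), -(μ * B₁); μ * A₂, 1 + μ * (B₂ - A₂)] := by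
    rw [hM]
    ext i j
    fin_cases i <;> fin_cases j <;> simp <;> ring
  have hdet : (1 - μ • M).det = 1 + A * μ + B * μ ^ 2 := by
    rw [hN, Matrix.det_fin_two_of, hA, hB]; ring
  refine ⟨?_, ?_, ?_⟩
  · rw [Matrix.isUnit_iff_isUnit_det, hdet]
    exact hD.ne'.isUnit
  · set D := 1 + A * μ + B * μ ^ 2 with hDdef
    have hinv : (1 - μ • M)⁻¹ =
        !![(1 + μ * (B₂ - A₂)) / D, μ * B₁ / D; -(μ * A₂) / D, (1 + μ * (B₁ - A₁)) / D] := by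
      rw [Matrix.inv_def, hdet, hN, Matrix.adjugate_fin_two_of]
      ext i j
      fin_cases i <;> fin_cases j <;> simp <;> ring
    have e1 : 0 < (1 + μ * (B₂ - A₂)) / D :=
      div_pos (by nlinarith [mul_pos hμ hB₂, mul_pos hμ (neg_pos.2 hA₂)]) hD
    have e2 : 0 < μ * B₁ / D := div_pos (mul_pos hμ hB₁) hD
    have e3 : 0 < -(μ * A₂) / D := div_pos (by nlinarith [mul_pos hμ (neg_pos.2 hA₂)]) hD
    have e4 : 0 < (1 + μ * (B₁ - A₁)) / D :=
      div_pos (by nlinarith [mul_pos hμ hB₁, mul_pos hμ (neg_pos.2 hA₁)]) hD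
    have r0 : ∑ l, |(1 - μ • M)⁻¹ 0 l| = (1 + (B₁ + B₂ - A₂) * μ) / D := by
      rw [hinv, Fin.sum_univ_two]
      change |(1 + μ * (B₂ - A₂)) / D| + |μ * B₁ / D| = _
      rw [abs_of_pos e1, abs_of_pos e2]; ring
    have r1 : ∑ l, |(1 - μ • M)⁻¹ 1 l| = (1 + (B₁ - A₁ - A₂) * μ) / D := by
      rw [hinv, Fin.sum_univ_two]
      change |-(μ * A₂) / D| + |(1 + μ * (B₁ - A₁)) / D| = _
      rw [abs_of_pos e3, abs_of_pos e4]; ring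
    apply le_antisymm
    · apply ciSup_le
      intro k
      fin_cases k
      · exact r0.trans_le (by gcongr)
      · exact r1.trans_le (by gcongr)
    · have hb : BddAbove (Set.range fun k : Fin 2 => ∑ l, |(1 - μ • M)⁻¹ k l|) :=
        (Set.finite_range _).bddAbove
      rcases max_choice (B₁ + B₂ - A₂) (B₁ - A₁ - A₂) with h | h
      · rw [ha, h, ← r0]; exact le_ciSup hb 0
      · rw [ha, h, ← r1]; exact le_ciSup hb 1
  · have h1 : lam ≤ A - a := hlam ▸ min_le_left _ _
    have h2 : lam ≤ B / a := hlam ▸ min_le_right _ _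
    rw [le_div_iff₀ ha0] at h2
    rw [← one_div, div_le_div_iff₀ hD (by positivity)]
    nlinarith [mul_nonneg (sub_nonneg.2 h1) hμ.le, mul_nonneg (sub_nonneg.2 h2) (sq_nonneg μ)]
end

section
/- Fix r ≥ 2 and real constants A_1,…,A_{r−1} < 0 and B_1,…,B_{r−1} > 0, and let M be the (r−1)×(r−1) tridiagonal matrix with diagonal entries M_{ii} = A_i − B_i, superdiagonal entries M_{i,i+1} = B_i, and subdiagonal entries M_{i+1,i} = −A_{i+1}. Then there exist a norm |·|_⋆ on ℝ^{r−1} and a constant λ > 0 such that for every μ > 0 the matrix I − μM is invertible and the operator norm of (I − μM)⁻¹ with respect to |·|_⋆ is at most (1 + μλ)^{−1}. -/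
open scoped BigOperators

/-- The `(r-1) × (r-1)` tridiagonal matrix (with `r - 1 = m + 1`) with diagonal entries
`A_i - B_i`, superdiagonal entries `B_i` and subdiagonal entries `-A_{i+1}`. -/
noncomputable def triM (m : ℕ) (A B : Fin (m + 1) → ℝ) :
    Matrix (Fin (m + 1)) (Fin (m + 1)) ℝ :=
  fun k l =>
    if l = k then A k - B k
    else if (l : ℕ) = (k : ℕ) + 1 then B k
    else if (k : ℕ) = (l : ℕ) + 1 then -A k
    else 0

lemma aux_sum (n j : ℕ) (c : ℝ) (hc : 0 ≤ c) :
    ∑ l : Fin n, (if (l : ℕ) = j then c else 0) ≤ c := by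
  rw [Fin.sum_univ_eq_sum_range (fun l => if l = j then c else 0) n, Finset.sum_ite_eq']
  split_ifs <;> linarith

lemma aux_exists_pos {n : ℕ} (f : Fin n → ℝ) (hf : ∀ i, 0 < f i) :
    ∃ t : ℝ, 0 < t ∧ ∀ i, t < f i := by
  induction n with
  | zero => exact ⟨1, one_pos, fun i => i.elim0⟩
  | succ n ih =>
    obtain ⟨t, ht, h⟩ := ih (fun i => f i.succ) (fun i => hf _)
    refine ⟨min t (f 0 / 2), lt_min ht (by linarith [hf 0]), fun i => ?_⟩
    refine Fin.cases ?_ (fun i => ?_) i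
    · exact lt_of_le_of_lt (min_le_right _ _) (by linarith [hf 0])
    · exact lt_of_le_of_lt (min_le_left _ _) (h i)

lemma aux_w (m : ℕ) (A B : Fin (m + 1) → ℝ)
    (hA : ∀ i, A i < 0) (hB : ∀ i, 0 < B i) :
    ∃ w : Fin (m + 1) → ℝ, (∀ k, 0 < w k) ∧ ∀ k, ∑ l, triM m A B k l * w l < 0 := by
  obtain ⟨t, ht, hlt⟩ := aux_exists_pos (fun i => -A i / B i)
    (fun i => div_pos (by linarith [hA i]) (hB i))
  set W : ℕ → ℝ := fun n => ∑ j ∈ Finset.range n, t ^ j with hW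
  have hW0 : ∀ n, 0 ≤ W n := fun n => Finset.sum_nonneg fun j _ => by positivity
  have hWs : ∀ n, W (n + 1) = W n + t ^ n := fun n => Finset.sum_range_succ _ _
  refine ⟨fun k => W (k + 1), fun k => ?_, fun k => ?_⟩
  · have := hW0 k
    have h2 : 0 < t ^ (k : ℕ) := by positivity
    simp only [hWs]; linarith
  have hAk := hA k
  have hBk := hB k
  have key : ∀ l, triM m A B k l * W (l + 1) ≤
      (if l = k then (A k - B k) * W (k + 1) else 0)
      + (if (l : ℕ) = (k : ℕ) + 1 then B k * W (k + 2) else 0)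
      + (if (l : ℕ) = (k : ℕ) - 1 then -A k * W k else 0) := by
    intro l
    have h3 : 0 ≤ -A k * W k := mul_nonneg (by linarith) (hW0 _)
    unfold triM
    by_cases h1 : l = k
    · subst h1
      simp only [if_true]
      split_ifs <;> first | omega | linarith
    · by_cases h2 : (l : ℕ) = (k : ℕ) + 1
      · simp only [h1, if_false, h2, if_true]
        split_ifs <;> linarith
      · by_cases h4 : (k : ℕ) = (l : ℕ) + 1
        · have h5 : (l : ℕ) = (k : ℕ) - 1 := by omega
          rw [if_neg h1, if_neg h2, if_pos h4, if_neg h1, if_neg h2, if_pos h5, h4]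
          simp
        · simp only [h1, if_false, h2, h4]
          split_ifs <;> linarith
  have h := Finset.sum_le_sum (fun l (_ : l ∈ Finset.univ) => key l)
  rw [Finset.sum_add_distrib, Finset.sum_add_distrib, Finset.sum_ite_eq' ] at h
  simp only [Finset.mem_univ, if_true] at h
  have e1 := aux_sum (m + 1) (k + 1) (B k * W (k + 2)) (mul_nonneg hBk.le (hW0 _))
  have e2 := aux_sum (m + 1) (k - 1) (-A k * W k) (mul_nonneg (by linarith) (hW0 _))
  have e3 : t * B k < -A k := (lt_div_iff₀ hBk).1 (hlt k)
  have e4 : 0 < t ^ (k : ℕ) := by positivity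
  have e5 := mul_pos (sub_pos.2 e3) e4
  have e6 : W (k + 2) = W k + t ^ (k : ℕ) + t ^ (k : ℕ) * t := by
    rw [hWs (k + 1), hWs k, pow_succ]
  rw [e6] at e1 h
  rw [hWs] at h
  refine lt_of_le_of_lt h ?_
  nlinarith

lemma aux_off (m : ℕ) (A B : Fin (m + 1) → ℝ)
    (hA : ∀ i, A i < 0) (hB : ∀ i, 0 < B i) (k l : Fin (m + 1)) (h : l ≠ k) :
    0 ≤ triM m A B k l := by
  unfold triM
  have := hA k
  have := hB k
  rw [if_neg h]
  split_ifs <;> linarith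

lemma aux_diag (m : ℕ) (A B : Fin (m + 1) → ℝ)
    (hA : ∀ i, A i < 0) (hB : ∀ i, 0 < B i) (k : Fin (m + 1)) :
    triM m A B k k ≤ 0 := by
  unfold triM
  have := hA k
  have := hB k
  rw [if_pos rfl]
  linarith

lemma aux_main {m : ℕ} (M : Matrix (Fin (m + 1)) (Fin (m + 1)) ℝ)
    (hoff : ∀ k l, l ≠ k → 0 ≤ M k l) (hd : ∀ k, M k k ≤ 0)
    (w : Fin (m + 1) → ℝ) (hw : ∀ k, 0 < w k) (lam : ℝ)
    (hl : ∀ k, ∑ l, M k l * w l ≤ - lam * w k) (μ : ℝ) (hμ : 0 < μ)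
    (x : Fin (m + 1) → ℝ) :
    (1 + μ * lam) * ‖fun k => x k / w k‖ ≤ ‖fun k => ((1 - μ • M).mulVec x) k / w k‖ := by
  set n := ‖fun k => x k / w k‖ with hn
  have hle : ∀ l, |x l| ≤ n * w l := fun l => by
    have := norm_le_pi_norm (fun k => x k / w k) l
    rwa [Real.norm_eq_abs, abs_div, abs_of_pos (hw l), div_le_iff₀ (hw l)] at this
  obtain ⟨k, hk⟩ : ∃ k, |x k| = n * w k := by
    obtain ⟨k, -, hk⟩ := Finset.exists_max_image Finset.univ (fun k => ‖x k / w k‖)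
      ⟨0, Finset.mem_univ _⟩
    refine ⟨k, le_antisymm (hle k) ?_⟩
    have : n ≤ ‖x k / w k‖ :=
      (pi_norm_le_iff_of_nonneg (norm_nonneg _)).2 fun i => hk i (Finset.mem_univ _)
    rwa [Real.norm_eq_abs, abs_div, abs_of_pos (hw k), le_div_iff₀ (hw k)] at this
  have hy := norm_le_pi_norm (fun k => ((1 - μ • M).mulVec x) k / w k) k
  refine le_trans ?_ hy
  rw [Real.norm_eq_abs, abs_div, abs_of_pos (hw k), le_div_iff₀ (hw k)]
  have e : ((1 - μ • M).mulVec x) k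
      = (1 - μ * M k k) * x k - μ * ∑ l ∈ Finset.univ.erase k, M k l * x l := by
    rw [Matrix.sub_mulVec, Matrix.one_mulVec, Matrix.smul_mulVec]
    simp only [Pi.sub_apply, Pi.smul_apply, smul_eq_mul, Matrix.mulVec, dotProduct]
    rw [← Finset.add_sum_erase _ _ (Finset.mem_univ k)]
    ring
  have hs : |∑ l ∈ Finset.univ.erase k, M k l * x l|
      ≤ n * ∑ l ∈ Finset.univ.erase k, M k l * w l := by
    refine (Finset.abs_sum_le_sum_abs _ _).trans ?_
    rw [Finset.mul_sum]
    refine Finset.sum_le_sum fun l hlk => ?_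
    have h0 := hoff k l (Finset.ne_of_mem_erase hlk)
    rw [abs_mul, abs_of_nonneg h0]
    nlinarith [mul_le_mul_of_nonneg_left (hle l) h0]
  have hlk := hl k
  rw [← Finset.add_sum_erase _ _ (Finset.mem_univ k)] at hlk
  have hn0 : 0 ≤ n := norm_nonneg _
  have hp : 0 ≤ 1 - μ * M k k := by nlinarith [hd k]
  have h1 := abs_sub_abs_le_abs_sub ((1 - μ * M k k) * x k)
    (μ * ∑ l ∈ Finset.univ.erase k, M k l * x l)
  rw [abs_mul, abs_mul, abs_of_nonneg hp, abs_of_pos hμ, hk, ← e] at h1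
  have h2 := mul_le_mul_of_nonneg_left hs hμ.le
  have h3 := mul_le_mul_of_nonneg_left hlk (mul_nonneg hμ.le hn0)
  linarith


/-- Fix `r = m + 2 ≥ 2` and constants `A_i < 0`, `B_i > 0`, and let `M` be
the tridiagonal matrix above.  Then there are a norm `|·|_⋆` on `ℝ^{r-1}` and a constant
`λ > 0` such that for every `μ > 0` the matrix `I - μM` is invertible and the operator norm
of `(I - μM)⁻¹` with respect to `|·|_⋆` is at most `(1 + μλ)⁻¹`. -/
theorem stmt9 (m : ℕ) (A B : Fin (m + 1) → ℝ)
    (hA : ∀ i, A i < 0) (hB : ∀ i, 0 < B i) :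
    ∃ (N : (Fin (m + 1) → ℝ) → ℝ) (lam : ℝ),
      (∀ x, 0 ≤ N x) ∧ (∀ x, N x = 0 ↔ x = 0) ∧
      (∀ (c : ℝ) (x), N (c • x) = |c| * N x) ∧
      (∀ x y, N (x + y) ≤ N x + N y) ∧
      0 < lam ∧
      ∀ μ : ℝ, 0 < μ →
        IsUnit (1 - μ • triM m A B) ∧
        ∀ ξ : Fin (m + 1) → ℝ,
          N ((1 - μ • triM m A B)⁻¹.mulVec ξ) ≤ (1 + μ * lam)⁻¹ * N ξ := by
  obtain ⟨w, hw, hneg⟩ := aux_w m A B hA hB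
  obtain ⟨lam, hlam, hl⟩ := aux_exists_pos
    (fun k => -(∑ l, triM m A B k l * w l) / w k)
    (fun k => div_pos (by linarith [hneg k]) (hw k))
  have hl' : ∀ k, ∑ l, triM m A B k l * w l ≤ - lam * w k := fun k => by
    have := (lt_div_iff₀ (hw k)).1 (hl k)
    linarith
  have key := aux_main (triM m A B) (aux_off m A B hA hB) (aux_diag m A B hA hB) w hw lam hl'
  have hz : ∀ x : Fin (m + 1) → ℝ, ‖fun k => x k / w k‖ = 0 ↔ x = 0 := by
    intro x
    rw [norm_eq_zero]
    constructor
    · intro h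
      funext k
      have := congrFun h k
      simpa [(hw k).ne'] using this
    · rintro rfl
      funext k
      simp
  refine ⟨fun x => ‖fun k => x k / w k‖, lam, fun x => norm_nonneg _, hz, ?_, ?_, hlam, ?_⟩
  · intro c x
    rw [← Real.norm_eq_abs, ← norm_smul]
    refine congrArg norm ?_
    funext k
    simp [mul_div_assoc]
  · intro x y
    refine le_trans (le_of_eq ?_) (norm_add_le _ _)
    refine congrArg norm ?_
    funext k
    simp [add_div]
  · intro μ hμ
    have hpos : 0 < 1 + μ * lam := by positivity
    have hu : IsUnit (1 - μ • triM m A B) := by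
      rw [← Matrix.mulVec_injective_iff_isUnit]
      intro x y hxy
      have hxy : (1 - μ • triM m A B).mulVec x = (1 - μ • triM m A B).mulVec y := hxy
      have h0 : (1 - μ • triM m A B).mulVec (x - y) = 0 := by
        rw [Matrix.mulVec_sub, hxy, sub_self]
      have h := key μ hμ (x - y)
      rw [h0, (hz 0).2 rfl] at h
      refine sub_eq_zero.1 ((hz _).1 (le_antisymm ?_ (norm_nonneg _)))
      exact nonpos_of_mul_nonpos_right h hpos
    refine ⟨hu, fun ξ => ?_⟩
    have h := key μ hμ ((1 - μ • triM m A B)⁻¹.mulVec ξ)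
    rw [Matrix.mulVec_mulVec, Matrix.mul_nonsing_inv _ ((Matrix.isUnit_iff_isUnit_det _).1 hu),
      Matrix.one_mulVec] at h
    rw [inv_mul_eq_div, le_div_iff₀ hpos, mul_comm]
    exact h
end

section
/- Let f : ℝ² → ℝ be C¹, strictly decreasing in its first argument, strictly increasing in its second argument, with f(0,0)=0, and suppose that for every v ∈ ℝ there exists w ∈ ℝ with v·f(v,w) ≥ 0. Then there exists a unique function h : ℝ → ℝ such that for all v, w ∈ ℝ: f(v,w) = 0 if and only if w = h(v). Moreover h is strictly increasing and h(0) = 0. -/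
/-- Let `f : ℝ² → ℝ` be C¹, strictly decreasing in its first argument,
strictly increasing in its second argument, with `f(0,0) = 0`, and suppose that for every
`v` there is a `w` with `v · f(v,w) ≥ 0`.  Then there is a unique function `h : ℝ → ℝ`
such that `f(v,w) = 0 ↔ w = h(v)` for all `v, w`; moreover `h` is strictly increasing and
`h(0) = 0`. -/
theorem stmt13 (f : ℝ → ℝ → ℝ)
    (hf1 : ContDiff ℝ 1 fun p : ℝ × ℝ => f p.1 p.2)
    (hf2 : ∀ w, StrictAnti fun v => f v w)
    (hf3 : ∀ v, StrictMono fun w => f v w)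
    (hf0 : f 0 0 = 0)
    (hsign : ∀ v : ℝ, ∃ w : ℝ, 0 ≤ v * f v w) :
    ∃ h : ℝ → ℝ,
      (∀ v w, f v w = 0 ↔ w = h v) ∧
      StrictMono h ∧ h 0 = 0 ∧
      ∀ h' : ℝ → ℝ, (∀ v w, f v w = 0 ↔ w = h' v) → h' = h := by
  have key : ∀ v, ∃ w, f v w = 0 := by
    intro v
    have hc : Continuous fun w => f v w :=
      hf1.continuous.comp (Continuous.prodMk_right v)
    obtain ⟨w, hw⟩ := hsign v
    rcases lt_trichotomy v 0 with hv | hv | hv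
    · have h0 : f 0 0 < f v 0 := hf2 0 hv
      have h1 : f v w ≤ 0 := by
        by_contra hcon
        push Not at hcon
        nlinarith [mul_neg_of_neg_of_pos hv hcon]
      exact mem_range_of_exists_le_of_exists_ge hc ⟨w, h1⟩ ⟨0, by linarith⟩
    · exact ⟨0, by rw [hv, hf0]⟩
    · have h0 : f v 0 < f 0 0 := hf2 0 hv
      have h1 : 0 ≤ f v w := nonneg_of_mul_nonneg_right hw hv
      exact mem_range_of_exists_le_of_exists_ge hc ⟨0, by linarith⟩ ⟨w, h1⟩
  choose h hh using key
  have hiff : ∀ v w, f v w = 0 ↔ w = h v := by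
    intro v w
    constructor
    · intro hw
      exact (hf3 v).injective (hw.trans (hh v).symm)
    · rintro rfl
      exact hh v
  refine ⟨h, hiff, ?_, ((hiff 0 0).1 hf0).symm, ?_⟩
  · intro a b hab
    have h1 : f b (h a) < f a (h a) := hf2 (h a) hab
    rw [hh a, ← hh b] at h1
    exact (hf3 b).lt_iff_lt.1 h1
  · intro h' hh'
    funext v
    exact (hiff v (h' v)).1 ((hh' v (h' v)).2 rfl)
end

section
/- Let η_1,…,η_r : ℝ → ℝ be convex C¹ functions and set η(U) = ∑_{i=1}^r η_i(u_i) and Ψ(U,V) = ∑_{i=1}^r [ (λ_i/2)(η_i(u_i) + η_i(v_i)) + (|λ_i|/2)(η_i(u_i) − η_i(v_i)) ] for U, V ∈ ℝ^r. Then Ψ satisfies the consistency relation Ψ(U,U) = ∑_{i=1}^r λ_i η_i(u_i), and every solution U of the semi-implicit upwind scheme with grid sizes satisfying the CFL condition obeys, for all j ∈ ℤ and n ≥ 0, the cell entropy inequality: η(U_j^{n+1}) ≤ η(U_j^n) − (Δt/Δx) ( Ψ(U_j^n, U_{j+1}^n) − Ψ(U_{j−1}^n, U_j^n) ) + (Δt/ε)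 ∇η(U_j^{n+1}) · Q(U_j^{n+1}). -/
open scoped BigOperators

noncomputable section

/-- The numerical entropy flux
`Ψ(U,V) = ∑_i [ (λ_i/2)(η_i(u_i) + η_i(v_i)) + (|λ_i|/2)(η_i(u_i) - η_i(v_i)) ]`. -/
def Psi (m : ℕ) (lam : Fin (m + 2) → ℝ) (ηs : Fin (m + 2) → ℝ → ℝ)
    (V W : Fin (m + 2) → ℝ) : ℝ :=
  ∑ i, (lam i / 2 * (ηs i (V i) + ηs i (W i)) + |lam i| / 2 * (ηs i (V i) - ηs i (W i)))

end

theorem tangent_aux (g : ℝ → ℝ) (hc : ConvexOn ℝ Set.univ g) (hd : Differentiable ℝ g) (x y : ℝ) :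
    g x + deriv g x * (y - x) ≤ g y := by
  rcases lt_trichotomy x y with h | h | h
  · have := hc.deriv_le_slope (Set.mem_univ x) (Set.mem_univ y) h (hd x)
    rw [slope_def_field, le_div_iff₀ (by linarith)] at this
    linarith
  · subst h; simp
  · have := hc.slope_le_deriv (Set.mem_univ y) (Set.mem_univ x) h (hd x)
    rw [slope_def_field, div_le_iff₀ (by linarith)] at this
    linarith

/-- **cell entropy inequality.** Let `η_1, …, η_r` be convex C¹ functions,
`η(U) = ∑ η_i(u_i)`, and `Ψ` the numerical entropy flux above.  Then `Ψ` satisfies the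
consistency relation `Ψ(U,U) = ∑ λ_i η_i(u_i)`, and every solution of the semi-implicit
upwind scheme with grid sizes satisfying the CFL condition obeys, for all `j, n`,
`η(U_j^{n+1}) ≤ η(U_j^n) - (Δt/Δx)(Ψ(U_j^n, U_{j+1}^n) - Ψ(U_{j-1}^n, U_j^n))
   + (Δt/ε) ∇η(U_j^{n+1}) · Q(U_j^{n+1})`. -/
theorem stmt16 (m : ℕ) (f : Fin (m + 1) → ℝ → ℝ → ℝ)
    (hf1 : ∀ i, ContDiff ℝ 1 fun p : ℝ × ℝ => f i p.1 p.2)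
    (hf2 : ∀ i w, StrictAnti fun v => f i v w)
    (hf3 : ∀ i v, StrictMono fun w => f i v w)
    (hf0 : ∀ i, f i 0 0 = 0)
    (lam : Fin (m + 2) → ℝ)
    (ηs : Fin (m + 2) → ℝ → ℝ)
    (hηconv : ∀ i, ConvexOn ℝ Set.univ (ηs i))
    (hηC1 : ∀ i, ContDiff ℝ 1 (ηs i))
    (Δt Δx ε : ℝ) (hΔt : 0 < Δt) (hΔx : 0 < Δx) (hε : 0 < ε)
    (hCFL : CFL m lam Δt Δx)
    (U : ℕ → ℤ → Fin (m + 2) → ℝ)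
    (hU : Scheme m f lam Δt Δx ε U) :
    (∀ V : Fin (m + 2) → ℝ, Psi m lam ηs V V = ∑ i, lam i * ηs i (V i)) ∧
    ∀ (n : ℕ) (j : ℤ),
      (∑ i, ηs i (U (n + 1) j i)) ≤
        (∑ i, ηs i (U n j i))
          - Δt / Δx * (Psi m lam ηs (U n j) (U n (j + 1))
              - Psi m lam ηs (U n (j - 1)) (U n j))
          + Δt / ε * ∑ i, deriv (ηs i) (U (n + 1) j i) * Qr m f (U (n + 1) j) i := by
  constructor
  · intro V
    unfold Psi
    exact Finset.sum_congr rfl fun i _ => by ring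
  · intro n j
    unfold Psi
    rw [← Finset.sum_sub_distrib, Finset.mul_sum, Finset.mul_sum, ← Finset.sum_sub_distrib,
      ← Finset.sum_add_distrib]
    refine Finset.sum_le_sum fun i _ => ?_
    have hs := hU n j i
    have hcfl := hCFL i
    have T := tangent_aux (ηs i) (hηconv i) ((hηC1 i).differentiable (by norm_num))
      (U (n + 1) j i)
    have T0 := T (U n j i)
    have T1 := T (U n (j - 1) i)
    have T2 := T (U n (j + 1) i)
    generalize Qr m f (U (n + 1) j) i = q at *
    generalize deriv (ηs i) (U (n + 1) j i) = d at *
    have hc : 0 < Δt / Δx := div_pos hΔt hΔx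
    have hq : Δt / ε * q = (U (n + 1) j i - U n j i)
      + Δt / Δx * ((lam i + |lam i|) / 2 * (U n j i - U n (j - 1) i))
      + Δt / Δx * ((lam i - |lam i|) / 2 * (U n (j + 1) i - U n j i)) := by
      have : Δt / ε * q = Δt * ((1 / ε) * q) := by ring
      rw [this, ← hs]
      field_simp
    have e : Δt / ε * (d * q) = d * (Δt / ε * q) := by ring
    rw [e, hq]
    have a1 : 0 ≤ Δt / Δx * ((lam i + |lam i|) / 2) :=
      mul_nonneg hc.le (by linarith [neg_abs_le (lam i)])
    have a2 : 0 ≤ Δt / Δx * ((|lam i| - lam i) / 2) :=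
      mul_nonneg hc.le (by linarith [le_abs_self (lam i)])
    have m0 := mul_le_mul_of_nonneg_left T0 (sub_nonneg.2 hcfl)
    have m1 := mul_le_mul_of_nonneg_left T1 a1
    have m2 := mul_le_mul_of_nonneg_left T2 a2
    linarith
end
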